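/- There exists ε > 0 such that the following holds for every 2×2 strictly hyperbolic system of conservation laws satisfying condition C_ε: there exists η > 0 such that for every open ball B contained in the ball B(0,η) ⊂ ℝ², there exist at least two distinct global weak solutions u₁, u₂ ∈ C⁰([0,∞) × 𝕋; B) of ∂ₜu + ∂ₓ f(u) = 0 with the same initial value u₁(0,·) = u₂(0,·). -/

import Mathlib

open MeasureTheory

noncomputable section

/-- The state space `ℝ²`, with the Euclidean norm. -/
abbrev E2 : Type := EuclideanSpace ℝ (Fin 2)

/-- Dot product on `ℝ²`. -/
def dot2 (a b : E2) : ℝ := a 0 * b 0 + a 1 * b 1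

/-- Determinant of the `2×2` matrix with columns `a, b`. -/
def det2 (a b : E2) : ℝ := a 0 * b 1 - a 1 * b 0

/-- A continuous weak solution of `∂ₜu + ∂ₓ f(u) = 0` on `[0,∞) × 𝕋` with values in `B`,
the torus `𝕋 = ℝ/ℤ` being realized by `1`-periodic functions on `ℝ`: `u` is continuous
on `[0,∞) × ℝ`, `1`-periodic in `x`, takes values in `B`, and satisfies the weak
formulation against every `1`-periodic-in-`x` test function `φ ∈ C¹` with compact
support in time. -/
def IsContWeakSol (f : E2 → E2) (B : Set E2) (u : ℝ × ℝ → E2) : Prop :=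
  ContinuousOn u (Set.Ici (0 : ℝ) ×ˢ Set.univ) ∧
  (∀ t x, u (t, x + 1) = u (t, x)) ∧
  (∀ t x, 0 ≤ t → u (t, x) ∈ B) ∧
  ∀ φ : ℝ × ℝ → ℝ, ContDiff ℝ 1 φ →
    (∀ t x, φ (t, x + 1) = φ (t, x)) →
    (∃ T : ℝ, ∀ t x, T ≤ |t| → φ (t, x) = 0) →
    ∀ i : Fin 2,
      (∫ t in Set.Ioi (0 : ℝ), ∫ x in Set.Ioc (0 : ℝ) 1,
          (u (t, x) i * fderiv ℝ φ (t, x) (1, 0)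
            + f (u (t, x)) i * fderiv ℝ φ (t, x) (0, 1)))
        + ∫ x in Set.Ioc (0 : ℝ) 1, u (0, x) i * φ (0, x) = 0

section helpers
open scoped ContDiff

/-- time derivative -/
def dtt {F : Type*} [NormedAddCommGroup F] [NormedSpace ℝ F] (g : ℝ × ℝ → F) (p : ℝ × ℝ) : F :=
  fderiv ℝ g p (1, 0)

/-- space derivative -/
def dxx {F : Type*} [NormedAddCommGroup F] [NormedSpace ℝ F] (g : ℝ × ℝ → F) (p : ℝ × ℝ) : F :=
  fderiv ℝ g p (0, 1)

section basics
variable {F : Type*} [NormedAddCommGroup F] [NormedSpace ℝ F]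

lemma fderiv_pair (g : ℝ × ℝ → F) (p : ℝ × ℝ) (a b : ℝ) :
    fderiv ℝ g p (a, b) = a • dtt g p + b • dxx g p := by
  have : ((a, b) : ℝ × ℝ) = a • ((1, 0) : ℝ × ℝ) + b • ((0, 1) : ℝ × ℝ) := by simp
  rw [this, map_add, map_smul, map_smul]; rfl

lemma curve_deriv {g : ℝ × ℝ → F} {α β : ℝ → ℝ} {s a b : ℝ}
    (hg : DifferentiableAt ℝ g (α s, β s)) (hα : HasDerivAt α a s) (hβ : HasDerivAt β b s) :
    HasDerivAt (fun r => g (α r, β r)) (a • dtt g (α s, β s) + b • dxx g (α s, β s)) s := by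
  have h := hg.hasFDerivAt.comp_hasDerivAt s (hα.prodMk hβ)
  rw [fderiv_pair] at h
  exact h

lemma hasDerivAt_dtt {g : ℝ × ℝ → F} {t x : ℝ} (hg : DifferentiableAt ℝ g (t, x)) :
    HasDerivAt (fun r => g (r, x)) (dtt g (t, x)) t := by
  simpa using curve_deriv (α := fun r => r) (β := fun _ => x) hg (hasDerivAt_id t)
    (hasDerivAt_const t x)

lemma hasDerivAt_dxx {g : ℝ × ℝ → F} {t x : ℝ} (hg : DifferentiableAt ℝ g (t, x)) :
    HasDerivAt (fun r => g (t, r)) (dxx g (t, x)) x := by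
  simpa using curve_deriv (α := fun _ => t) (β := fun r => r) hg (hasDerivAt_const x t)
    (hasDerivAt_id x)

lemma ContDiff.dtt {g : ℝ × ℝ → F} (hg : ContDiff ℝ ∞ g) : ContDiff ℝ ∞ (dtt g) := by
  unfold _root_.dtt
  exact (hg.fderiv_right (m := ∞) (by simp)).clm_apply contDiff_const

lemma ContDiff.dxx {g : ℝ × ℝ → F} (hg : ContDiff ℝ ∞ g) : ContDiff ℝ ∞ (dxx g) := by
  unfold _root_.dxx
  exact (hg.fderiv_right (m := ∞) (by simp)).clm_apply contDiff_const

lemma smooth_diff {g : ℝ × ℝ → F} (hg : ContDiff ℝ ∞ g) (p : ℝ × ℝ) : DifferentiableAt ℝ g p :=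
  (hg.differentiable (by simp)).differentiableAt

lemma fderiv_quasi {g : ℝ × ℝ → F} {c : F} (h : ∀ t x, g (t, x + 1) = g (t, x) + c) (t x : ℝ) :
    fderiv ℝ g (t, x + 1) = fderiv ℝ g (t, x) := by
  have h1 : (fun p => g (p + ((0, 1) : ℝ × ℝ))) = fun p => g p + c := by
    ext ⟨t, x⟩
    simp [h]
  have h2 := fderiv_comp_add_right (𝕜 := ℝ) (f := g) (x := (t, x)) ((0, 1) : ℝ × ℝ)
  rw [h1, fderiv_add_const] at h2
  rw [h2]; simp

lemma dtt_quasi {g : ℝ × ℝ → F} {c : F} (h : ∀ t x, g (t, x + 1) = g (t, x) + c) (t x : ℝ) :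
    dtt g (t, x + 1) = dtt g (t, x) := by simp only [dtt, fderiv_quasi h]

lemma dxx_quasi {g : ℝ × ℝ → F} {c : F} (h : ∀ t x, g (t, x + 1) = g (t, x) + c) (t x : ℝ) :
    dxx g (t, x + 1) = dxx g (t, x) := by simp only [dxx, fderiv_quasi h]

lemma bdd_of_per {g : ℝ × ℝ → F} (hg : Continuous g) (per : ∀ t x, g (t, x + 1) = g (t, x))
    {z : F} (hz : ∀ t x, t < 1 ∨ 4 < t → g (t, x) = z) : ∃ C, 0 ≤ C ∧ ∀ p, ‖g p‖ ≤ C := by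
  obtain ⟨C, hC⟩ := ((isCompact_Icc (a := (1:ℝ)) (b := 4)).prod
    (isCompact_Icc (a := (0:ℝ)) (b := 1))).exists_bound_of_continuousOn hg.continuousOn
  refine ⟨max C ‖z‖, le_max_of_le_right (norm_nonneg _), ?_⟩
  rintro ⟨t, x⟩
  by_cases ht : t < 1 ∨ 4 < t
  · rw [hz t x ht]; exact le_max_right _ _
  · push Not at ht
    have hp : Function.Periodic (fun x => g (t, x)) 1 := fun x => per t x
    obtain ⟨y, hy, hxy⟩ := hp.exists_mem_Ico₀ one_pos x
    change g (t, x) = g (t, y) at hxy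
    rw [hxy]
    exact le_max_of_le_left (hC (t, y) ⟨⟨ht.1, ht.2⟩, ⟨hy.1, hy.2.le⟩⟩)

/-- derivatives on the region where `g` does not change -/
lemma fderiv_out {g g' : ℝ × ℝ → F} {a b : ℝ} (h : ∀ t x, t < a ∨ b < t → g (t, x) = g' (t, x))
    (t x : ℝ) (ht : t < a ∨ b < t) : fderiv ℝ g (t, x) = fderiv ℝ g' (t, x) := by
  apply Filter.EventuallyEq.fderiv_eq
  have ho : IsOpen {p : ℝ × ℝ | p.1 < a ∨ b < p.1} :=
    (isOpen_lt continuous_fst continuous_const).union (isOpen_lt continuous_const continuous_fst)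
  filter_upwards [ho.mem_nhds (show (t, x) ∈ {p : ℝ × ℝ | p.1 < a ∨ b < p.1} from ht)] with p hp
  exact h p.1 p.2 hp

lemma exists_antideriv {g : ℝ → ℝ} (hg : ContDiff ℝ ∞ g) :
    ∃ G : ℝ → ℝ, ContDiff ℝ ∞ G ∧ G 0 = 0 ∧ ∀ t, HasDerivAt G (g t) t := by
  have hd : ∀ t, HasDerivAt (fun t => ∫ s in (0:ℝ)..t, g s) (g t) t := fun t =>
    intervalIntegral.integral_hasDerivAt_right (hg.continuous.intervalIntegrable _ _)
      (hg.continuous.stronglyMeasurableAtFilter _ _) hg.continuous.continuousAt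
  refine ⟨fun t => ∫ s in (0:ℝ)..t, g s, ?_, by simp, hd⟩
  rw [contDiff_infty_iff_deriv]
  refine ⟨fun t => (hd t).differentiableAt, ?_⟩
  have : deriv (fun t => ∫ s in (0:ℝ)..t, g s) = g := funext fun t => (hd t).deriv
  rw [this]; exact hg

end basics

/-- smooth clamp: identity for `t ≤ T - h`, bounded by `T`. -/
lemma exists_clamp (T h : ℝ) (hh : 0 < h) : ∃ θ θ' : ℝ → ℝ, ContDiff ℝ ∞ θ ∧
    (∀ t, HasDerivAt θ (θ' t) t) ∧ (∀ t, 0 ≤ θ' t ∧ θ' t ≤ 1) ∧ (∀ t, t ≤ T - h → θ t = t) ∧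
    (∀ t, t ≤ T - h → θ' t = 1) ∧
    (∀ t, T ≤ t → θ' t = 0) ∧ (∀ t, θ t ≤ T) ∧ (∀ t, θ t ≤ t) ∧ (∀ t, T - h ≤ t → T - h ≤ θ t) := by
  obtain ⟨G, hG, hG0, hGd⟩ := exists_antideriv
    (g := fun s => 1 - Real.smoothTransition s) (contDiff_const.sub Real.smoothTransition.contDiff)
  set θ : ℝ → ℝ := fun t => T - h + h * G ((t - (T - h)) / h) with hθ
  have hd : ∀ t, HasDerivAt θ (1 - Real.smoothTransition ((t - (T - h)) / h)) t := by
    intro t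
    have h1 : HasDerivAt (fun t => (t - (T - h)) / h) (1 / h) t :=
      ((hasDerivAt_id t).sub_const _).div_const _
    have h2 := (((hGd ((t - (T - h)) / h)).comp t h1).const_mul h).const_add (T - h)
    have h6 : h * ((1 - Real.smoothTransition ((t - (T - h)) / h)) * (1 / h)) =
        1 - Real.smoothTransition ((t - (T - h)) / h) := by
      generalize Real.smoothTransition ((t - (T - h)) / h) = q
      field_simp
    rw [h6] at h2
    exact h2
  have hb : ∀ t, 0 ≤ 1 - Real.smoothTransition ((t - (T - h)) / h) ∧
      1 - Real.smoothTransition ((t - (T - h)) / h) ≤ 1 := by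
    intro t
    have := Real.smoothTransition.nonneg ((t - (T - h)) / h)
    have := Real.smoothTransition.le_one ((t - (T - h)) / h)
    constructor <;> linarith
  have hdd : Differentiable ℝ θ := fun t => (hd t).differentiableAt
  have hmono : Monotone θ := monotone_of_deriv_nonneg hdd (fun t => by rw [(hd t).deriv]; exact (hb t).1)
  have hbase : θ (T - h) = T - h := by simp [hθ, hG0]
  have hone : ∀ t, t ≤ T - h → Real.smoothTransition ((t - (T - h)) / h) = 0 := fun t ht =>
    Real.smoothTransition.zero_of_nonpos (div_nonpos_of_nonpos_of_nonneg (by linarith) hh.le)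
  have hzero : ∀ t, T ≤ t → Real.smoothTransition ((t - (T - h)) / h) = 1 := fun t ht =>
    Real.smoothTransition.one_of_one_le (by rw [le_div_iff₀ hh]; linarith)
  have hid : ∀ t, t ≤ T - h → θ t = t := by
    intro t ht
    have := (convex_Iic (T - h)).is_const_of_fderivWithin_eq_zero (𝕜 := ℝ) (f := fun t => θ t - t) 
      (fun s _ => ((hdd s).sub differentiableAt_id).differentiableWithinAt) (by
        intro s hs
        have h3 : HasDerivAt (fun t => θ t - t) 0 s := by
          have := (hd s).sub (hasDerivAt_id s)
          rw [hone s hs, sub_zero, sub_self] at this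
          exact this
        have h4 := h3.hasFDerivAt.hasFDerivWithinAt (s := Set.Iic (T - h))
        rw [h4.fderivWithin ((uniqueDiffOn_Iic _) s hs)]
        ext; simp) (show t ∈ Set.Iic (T-h) from ht) (Set.mem_Iic.2 (le_refl (T - h)))
    simp only [hbase] at this
    linarith
  have hanti : Antitone (fun t => θ t - t) := by
    apply antitone_of_deriv_nonpos (hdd.sub differentiable_id)
    intro t
    have := ((hd t).sub (hasDerivAt_id t)).deriv
    have h5 := (hb t).2
    change deriv (θ - id) t ≤ 0
    rw [this]; linarith
  have hle : ∀ t, θ t ≤ t := by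
    intro t
    rcases le_total t (T - h) with ht | ht
    · exact (hid t ht).le
    · have := hanti ht
      simp only [hbase] at this
      linarith
  refine ⟨θ, fun t => 1 - Real.smoothTransition ((t - (T - h)) / h), ?_, hd, hb, hid,
    fun t ht => by simp [hone t ht], fun t ht => by simp [hzero t ht], ?_, hle, ?_⟩
  · exact contDiff_const.add (contDiff_const.mul (hG.comp ((contDiff_id.sub contDiff_const).div_const _)))
  · intro t
    rcases le_total t T with ht | ht
    · exact (hle t).trans ht
    · -- constant after T
      have : θ t = θ T := by
        have := (convex_Ici T).is_const_of_fderivWithin_eq_zero (𝕜 := ℝ) (f := θ) 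
          (fun s _ => (hdd s).differentiableWithinAt) (by
            intro s hs
            have h3 : HasDerivAt θ 0 s := by
              have := hd s
              rwa [hzero s hs, sub_self] at this
            have h4 := h3.hasFDerivAt.hasFDerivWithinAt (s := Set.Ici T)
            rw [h4.fderivWithin ((uniqueDiffOn_Ici _) s hs)]
            ext; simp) (show t ∈ Set.Ici T from ht) (Set.mem_Ici.2 (le_refl T))
        exact this
      rw [this]; exact hle T
  · intro t ht
    have := hmono ht
    rwa [hbase] at this

/-- `φ` is an approximate phase up to time `T`. -/
def PhaseUpTo (Λ : ℝ × ℝ → ℝ) (τ h T : ℝ) (φ : ℝ × ℝ → ℝ) : Prop :=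
  ContDiff ℝ ∞ φ ∧ (∀ t x, φ (t, x + 1) = φ (t, x) + 2 * Real.pi) ∧
  (∀ t x, t ≤ T → 0 < dxx φ (t, x)) ∧
  (∀ t x, t ≤ T → |dtt φ (t, x) + Λ (t, x) * dxx φ (t, x)| ≤ 2 * τ * dxx φ (t, x)) ∧
  (∀ t x, T - h ≤ t → t ≤ T → |dtt φ (t, x) + Λ (t, x) * dxx φ (t, x)| ≤ τ * dxx φ (t, x))

lemma phase_step {Λ : ℝ × ℝ → ℝ} (hΛ : ContDiff ℝ ∞ Λ) (per : ∀ t x, Λ (t, x + 1) = Λ (t, x))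
    {L : ℝ} (hL : 0 ≤ L) (h1 : ∀ p, |Λ p| ≤ L) (h2 : ∀ p, |dxx Λ p| ≤ L)
    (h3 : ∀ p q, |Λ p - Λ q| ≤ L * ‖p - q‖) {τ h : ℝ} (hh : 0 < h)
    (hs1 : 2 * h * L + 4 * h * L ^ 2 ≤ τ / 4) (hs2 : 2 * h * L ≤ 1 / 4) {T : ℝ} {φ : ℝ × ℝ → ℝ}
    (hφ : PhaseUpTo Λ τ h T φ) : ∃ φ', PhaseUpTo Λ τ h (T + h) φ' := by
  obtain ⟨hsm, hper, hpos, he2, he1⟩ := hφ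
  obtain ⟨θ, θ', hθ, hθd, hθb, hid, hid', hz, hθT, hθt, hθl⟩ := exists_clamp T h hh
  have hτ : 0 ≤ τ := by nlinarith [mul_nonneg hh.le hL, mul_nonneg hh.le (sq_nonneg L)]
  set φ' : ℝ × ℝ → ℝ := fun p => φ (θ p.1, p.2 - (p.1 - θ p.1) * Λ (T, p.2)) with hφ'
  have hsm' : ContDiff ℝ ∞ φ' := by
    apply hsm.comp
    apply ContDiff.prodMk (hθ.comp contDiff_fst)
    exact contDiff_snd.sub ((contDiff_fst.sub (hθ.comp contDiff_fst)).mul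
      (hΛ.comp (contDiff_const.prodMk contDiff_snd)))
  have hdt : ∀ t x, dtt φ' (t, x) = θ' t * dtt φ (θ t, x - (t - θ t) * Λ (T, x)) +
      (-((1 - θ' t) * Λ (T, x))) * dxx φ (θ t, x - (t - θ t) * Λ (T, x)) := by
    intro t x
    have a1 := hasDerivAt_dtt (smooth_diff hsm' (t, x))
    have a2 := curve_deriv (g := φ) (α := θ) (β := fun r => x - (r - θ r) * Λ (T, x)) (s := t)
      (smooth_diff hsm _) (hθd t)
      ((((hasDerivAt_id t).sub (hθd t)).mul_const (Λ (T, x))).const_sub x)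
    exact a1.unique a2
  have hdx : ∀ t x, dxx φ' (t, x) = (1 - (t - θ t) * dxx Λ (T, x)) *
      dxx φ (θ t, x - (t - θ t) * Λ (T, x)) := by
    intro t x
    have a1 := hasDerivAt_dxx (smooth_diff hsm' (t, x))
    have a2 := curve_deriv (g := φ) (α := fun _ => θ t) (β := fun r => r - (t - θ t) * Λ (T, r))
      (s := x) (smooth_diff hsm _) (hasDerivAt_const x _)
      ((hasDerivAt_id x).sub ((hasDerivAt_dxx (smooth_diff hΛ (T, x))).const_mul (t - θ t)))
    have := a1.unique a2
    rw [this]; simp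
  have hfac : ∀ t x, t ≤ T + h → 3 / 4 ≤ 1 - (t - θ t) * dxx Λ (T, x) := by
    intro t x ht
    have b1 := h2 (T, x)
    have b2 := hθt t
    have b3 : t - θ t ≤ 2 * h := by
      rcases le_total t (T - h) with q | q
      · rw [hid t q]; linarith
      · have := hθl t q; linarith
    have b4 : (t - θ t) * dxx Λ (T, x) ≤ 2 * h * L := by
      rcases le_total 0 (dxx Λ (T, x)) with q | q
      · exact mul_le_mul b3 (le_trans (le_abs_self _) b1) q (by linarith)
      · have : (t - θ t) * dxx Λ (T, x) ≤ 0 := mul_nonpos_of_nonneg_of_nonpos (by linarith) q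
        have : 0 ≤ 2 * h * L := by positivity
        linarith
    linarith
  -- key error estimate
  have hkey : ∀ t x e, T - h ≤ t → t ≤ T + h →
      θ' t * |dtt φ (θ t, x - (t - θ t) * Λ (T, x)) + Λ (θ t, x - (t - θ t) * Λ (T, x)) *
        dxx φ (θ t, x - (t - θ t) * Λ (T, x))| ≤ e * dxx φ (θ t, x - (t - θ t) * Λ (T, x)) →
      |dtt φ' (t, x) + Λ (t, x) * dxx φ' (t, x)| ≤
        (e + τ / 4) * dxx φ (θ t, x - (t - θ t) * Λ (T, x)) := by
    intro t x e ht1 ht2 he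
    rw [hdt, hdx]
    have hp := hpos (θ t) (x - (t - θ t) * Λ (T, x)) (hθT t)
    have c1 := h3 (t, x) (θ t, x - (t - θ t) * Λ (T, x))
    have c2 := h3 (t, x) (T, x)
    have c3 := h1 (t, x)
    have c3' := h1 (T, x)
    have c4 := h2 (T, x)
    have b2 := hθt t
    have b3 : t - θ t ≤ 2 * h := by have := hθl t ht1; linarith
    have n1 : ‖((t, x) : ℝ × ℝ) - (θ t, x - (t - θ t) * Λ (T, x))‖ ≤ 2 * h + 2 * h * L := by
      rw [Prod.mk_sub_mk, Prod.norm_mk]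
      apply max_le
      · rw [Real.norm_eq_abs, abs_of_nonneg (by linarith)]
        nlinarith [mul_nonneg hh.le hL]
      · rw [Real.norm_eq_abs, sub_sub_cancel, abs_mul, abs_of_nonneg (by linarith : 0 ≤ t - θ t)]
        have := mul_le_mul b3 c3' (abs_nonneg _) (by linarith)
        linarith
    have n2 : ‖((t, x) : ℝ × ℝ) - (T, x)‖ ≤ 2 * h + 2 * h * L := by
      rw [Prod.mk_sub_mk, Prod.norm_mk]
      have : 0 ≤ h * L := mul_nonneg hh.le hL
      apply max_le
      · rw [Real.norm_eq_abs, abs_le]; constructor <;> linarith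
      · simp; nlinarith
    have c1' := c1.trans (mul_le_mul_of_nonneg_left n1 hL)
    have c2' := c2.trans (mul_le_mul_of_nonneg_left n2 hL)
    have c5 : |Λ (t, x) * ((t - θ t) * dxx Λ (T, x))| ≤ L * (2 * h * L) := by
      rw [abs_mul, abs_mul, abs_of_nonneg (by linarith : 0 ≤ t - θ t)]
      exact mul_le_mul c3 (mul_le_mul b3 c4 (abs_nonneg _) (by linarith))
        (mul_nonneg (by linarith) (abs_nonneg _)) hL
    generalize dtt φ (θ t, x - (t - θ t) * Λ (T, x)) = A at *
    generalize dxx φ (θ t, x - (t - θ t) * Λ (T, x)) = B at *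
    generalize Λ (θ t, x - (t - θ t) * Λ (T, x)) = l1 at *
    obtain ⟨u1, u2⟩ := hθb t
    generalize θ' t = w at *
    have split : w * A + -((1 - w) * Λ (T, x)) * B +
        Λ (t, x) * ((1 - (t - θ t) * dxx Λ (T, x)) * B) =
        w * (A + l1 * B) + (w * (Λ (t, x) - l1) + (1 - w) * (Λ (t, x) - Λ (T, x)) -
          Λ (t, x) * ((t - θ t) * dxx Λ (T, x))) * B := by ring
    rw [split]
    have e1 : |w * (Λ (t, x) - l1) + (1 - w) * (Λ (t, x) - Λ (T, x)) -
          Λ (t, x) * ((t - θ t) * dxx Λ (T, x))| ≤ τ / 4 := by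
      have d1 : |w * (Λ (t, x) - l1)| ≤ w * (L * (2 * h + 2 * h * L)) := by
        rw [abs_mul, abs_of_nonneg u1]; exact mul_le_mul_of_nonneg_left c1' u1
      have d2 : |(1 - w) * (Λ (t, x) - Λ (T, x))| ≤ (1 - w) * (L * (2 * h + 2 * h * L)) := by
        rw [abs_mul, abs_of_nonneg (by linarith : 0 ≤ 1 - w)]
        exact mul_le_mul_of_nonneg_left c2' (by linarith)
      have d3 := abs_sub (w * (Λ (t, x) - l1) + (1 - w) * (Λ (t, x) - Λ (T, x)))
        (Λ (t, x) * ((t - θ t) * dxx Λ (T, x)))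
      have d4 := abs_add_le (w * (Λ (t, x) - l1)) ((1 - w) * (Λ (t, x) - Λ (T, x)))
      nlinarith
    refine (abs_add_le _ _).trans ?_
    rw [abs_mul, abs_mul, abs_of_nonneg u1, abs_of_pos hp]
    have := mul_le_mul_of_nonneg_right e1 hp.le
    linarith
  refine ⟨φ', hsm', ?_, ?_, ?_, ?_⟩
  · intro t x
    simp only [hφ', per]
    rw [← hper]; congr 2; ring
  · intro t x ht
    rw [hdx]
    exact mul_pos (by linarith [hfac t x ht]) (hpos _ _ (hθT t))
  · intro t x ht
    have hp := hpos (θ t) (x - (t - θ t) * Λ (T, x)) (hθT t)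
    rcases le_total t (T - h) with q | q
    · have := he2 t x (by linarith)
      rw [hdt, hdx, hid t q, hid' t q]
      simpa using this
    · rcases le_total t T with q' | q'
      · have k := hkey t x τ q ht (by
          have := he1 (θ t) (x - (t - θ t) * Λ (T, x)) (hθl t q) (hθT t)
          obtain ⟨u1, u2⟩ := hθb t
          exact (mul_le_of_le_one_left (abs_nonneg _) u2).trans this)
        refine k.trans ?_
        rw [hdx]
        have := mul_le_mul_of_nonneg_right (hfac t x ht) hp.le
        nlinarith [mul_nonneg hτ hp.le]
      · have k := hkey t x 0 q ht (by rw [hz t q']; simp)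
        refine k.trans ?_
        rw [hdx]
        have := mul_le_mul_of_nonneg_right (hfac t x ht) hp.le
        nlinarith [mul_nonneg hτ hp.le]
  · intro t x ht' ht
    have hp := hpos (θ t) (x - (t - θ t) * Λ (T, x)) (hθT t)
    have k := hkey t x 0 (by linarith) ht (by rw [hz t (by linarith)]; simp)
    refine k.trans ?_
    rw [hdx]
    have := mul_le_mul_of_nonneg_right (hfac t x ht) hp.le
    nlinarith [mul_nonneg hτ hp.le]

lemma exists_phase {Λ : ℝ × ℝ → ℝ} (hΛ : ContDiff ℝ ∞ Λ) (per : ∀ t x, Λ (t, x + 1) = Λ (t, x))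
    {l0 : ℝ} (hout : ∀ t x, t < 1 ∨ 4 < t → Λ (t, x) = l0) {τ : ℝ} (hτ : 0 < τ) :
    ∃ φ : ℝ × ℝ → ℝ, ContDiff ℝ ∞ φ ∧ (∀ t x, φ (t, x + 1) = φ (t, x) + 2 * Real.pi) ∧
      (∀ p, 0 < dxx φ p) ∧
      ∀ t x, t ≤ 4 → |dtt φ (t, x) + Λ (t, x) * dxx φ (t, x)| ≤ τ * dxx φ (t, x) := by
  have per' : ∀ t x, Λ (t, x + 1) = Λ (t, x) + 0 := by simpa using per
  obtain ⟨L1, hL1, hb1⟩ := bdd_of_per hΛ.continuous per hout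
  obtain ⟨L2, hL2, hb2⟩ := bdd_of_per (g := fderiv ℝ Λ) (hΛ.continuous_fderiv (by simp))
    (fun t x => fderiv_quasi per' t x) (z := 0) (fun t x ht => by
      rw [fderiv_out (g' := fun _ => l0) hout t x ht]; simp)
  set L := max L1 L2 with hLd
  have hL : 0 ≤ L := le_max_of_le_left hL1
  have h1 : ∀ p, |Λ p| ≤ L := fun p => (hb1 p).trans (le_max_left _ _)
  have h2 : ∀ p, |dxx Λ p| ≤ L := by
    intro p
    have := (fderiv ℝ Λ p).le_opNorm ((0, 1) : ℝ × ℝ)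
    simp only [Prod.norm_mk, norm_zero, norm_one] at this
    simp only [zero_le_one, sup_of_le_right, mul_one] at this
    exact this.trans ((hb2 p).trans (le_max_right _ _))
  have h3 : ∀ p q, |Λ p - Λ q| ≤ L * ‖p - q‖ := by
    intro p q
    exact convex_univ.norm_image_sub_le_of_norm_fderiv_le (𝕜 := ℝ)
      (fun x _ => smooth_diff hΛ x) (fun x _ => (hb2 x).trans (le_max_right _ _))
      (Set.mem_univ q) (Set.mem_univ p)
  set h := min (τ / 2 / 4 / (2 * L + 4 * L ^ 2 + 1)) (1 / 4 / (2 * L + 1)) with hhd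
  have hh : 0 < h := by positivity
  have hs1 : 2 * h * L + 4 * h * L ^ 2 ≤ τ / 2 / 4 := by
    have := min_le_left (τ / 2 / 4 / (2 * L + 4 * L ^ 2 + 1)) (1 / 4 / (2 * L + 1))
    rw [← hhd, le_div_iff₀ (by positivity)] at this
    nlinarith
  have hs2 : 2 * h * L ≤ 1 / 4 := by
    have := min_le_right (τ / 2 / 4 / (2 * L + 4 * L ^ 2 + 1)) (1 / 4 / (2 * L + 1))
    rw [← hhd, le_div_iff₀ (by positivity)] at this
    nlinarith
  have hall : ∀ n : ℕ, ∃ φ, PhaseUpTo Λ (τ / 2) h (n * h) φ := by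
    intro n
    induction n with
    | zero =>
      have hd : ∀ p : ℝ × ℝ, HasFDerivAt (fun p : ℝ × ℝ => 2 * Real.pi * (p.2 - l0 * p.1))
          ((2 * Real.pi) • (ContinuousLinearMap.snd ℝ ℝ ℝ - l0 • ContinuousLinearMap.fst ℝ ℝ ℝ)) p :=
        fun p => (hasFDerivAt_snd.sub (hasFDerivAt_fst.const_mul l0)).const_mul _
      have hdt : ∀ p, dtt (fun p : ℝ × ℝ => 2 * Real.pi * (p.2 - l0 * p.1)) p = 
        2 * Real.pi * (- l0) := fun p => by simp [dtt, (hd p).fderiv]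
      have hdx : ∀ p, dxx (fun p : ℝ × ℝ => 2 * Real.pi * (p.2 - l0 * p.1)) p = 
        2 * Real.pi := fun p => by simp [dxx, (hd p).fderiv]
      refine ⟨fun p => 2 * Real.pi * (p.2 - l0 * p.1), ?_, ?_, ?_, ?_, ?_⟩
      · fun_prop
      · intro t x; simp only; ring
      · intro t x _; rw [hdx]; positivity
      · intro t x ht
        rw [hdx, hdt, hout t x (Or.inl (by simp at ht; linarith))]
        have : 2 * Real.pi * -l0 + l0 * (2 * Real.pi) = 0 := by ring
        rw [this, abs_zero]; positivity
      · intro t x _ ht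
        rw [hdx, hdt, hout t x (Or.inl (by simp at ht; linarith))]
        have : 2 * Real.pi * -l0 + l0 * (2 * Real.pi) = 0 := by ring
        rw [this, abs_zero]; positivity
    | succ n ih =>
      obtain ⟨φ, hφ⟩ := ih
      have := phase_step hΛ per hL h1 h2 h3 hh hs1 hs2 hφ
      have e : ((n + 1 : ℕ) : ℝ) * h = n * h + h := by push_cast; ring
      rw [e]; exact this
  obtain ⟨n, hn⟩ := exists_nat_gt (5 / h)
  rw [div_lt_iff₀ hh] at hn
  obtain ⟨φ, hsm, hper, hpos, he2, -⟩ := hall n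
  obtain ⟨θ, θ', hθ, hθd, hθb, hid, hid', hz, hθT, hθt, hθl⟩ := exists_clamp 5 1 one_pos
  set φ' : ℝ × ℝ → ℝ := fun p => φ (θ p.1, p.2) with hφ'
  have hsm' : ContDiff ℝ ∞ φ' := hsm.comp ((hθ.comp contDiff_fst).prodMk contDiff_snd)
  have hdt : ∀ t x, dtt φ' (t, x) = θ' t * dtt φ (θ t, x) := by
    intro t x
    have a1 := hasDerivAt_dtt (smooth_diff hsm' (t, x))
    have a2 := curve_deriv (g := φ) (α := θ) (β := fun _ => x) (s := t)
      (smooth_diff hsm _) (hθd t) (hasDerivAt_const t x)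
    have := a1.unique a2
    rw [this]; simp
  have hdx : ∀ t x, dxx φ' (t, x) = dxx φ (θ t, x) := by
    intro t x
    have a1 := hasDerivAt_dxx (smooth_diff hsm' (t, x))
    exact a1.unique (hasDerivAt_dxx (smooth_diff hsm (θ t, x)))
  refine ⟨φ', hsm', fun t x => hper _ _, ?_, ?_⟩
  · rintro ⟨t, x⟩
    rw [hdx]; exact hpos _ _ (by linarith [hθT t])
  · intro t x ht
    rw [hdt, hdx, hid' t (by linarith), hid t (by linarith), one_mul]
    have := he2 t x (by linarith)
    convert this using 2; ring

section pointwise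
variable {X : Type*} [NormedAddCommGroup X] [NormedSpace ℝ X]

lemma taylor2 {V : Set X} (hV : IsOpen V) (h0 : (0 : X) ∈ V) {f : X → X}
    (hf : ContDiffOn ℝ ∞ f V) {σ : ℝ} (hσ : 0 < σ) :
    ∃ η > 0, Metric.ball 0 η ⊆ V ∧ ∀ v w : X, ‖v‖ < η → ‖v + w‖ < η →
      ‖f (v + w) - f v - fderiv ℝ f v w - (1 / 2 : ℝ) • fderiv ℝ (fderiv ℝ f) 0 w w‖ ≤ σ * ‖w‖ ^ 2 := by
  have hf2 : ContDiffAt ℝ ∞ (fderiv ℝ f) 0 :=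
    (hf.contDiffAt (hV.mem_nhds h0)).fderiv_right (m := ∞) (by simp)
  have hst := (hf2.hasStrictFDerivAt (by simp)).isLittleO
  have hb := (hst.bound hσ)
  rw [nhds_prod_eq] at hb
  obtain ⟨U, hU, hU2⟩ := Filter.eventually_prod_self_iff'.1 hb
  obtain ⟨η, hη, hball⟩ := Metric.mem_nhds_iff.1 (Filter.inter_mem hU (hV.mem_nhds h0))
  refine ⟨η, hη, fun x hx => (hball hx).2, ?_⟩
  intro v w hv hw
  have hseg : ∀ s ∈ Set.Icc (0:ℝ) 1, v + s • w ∈ Metric.ball (0 : X) η := by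
    intro s hs
    have hc := convex_ball (0 : X) η
    have := hc.add_smul_sub_mem (x := v) (y := v + w) (by simpa using hv) (by simpa using hw) hs
    simpa using this
  have hd : ∀ s ∈ Set.Icc (0:ℝ) 1, HasDerivAt (fun s : ℝ => f (v + s • w) - s • fderiv ℝ f v w -
      (s ^ 2 / 2) • fderiv ℝ (fderiv ℝ f) 0 w w)
      (fderiv ℝ f (v + s • w) w - fderiv ℝ f v w - s • fderiv ℝ (fderiv ℝ f) 0 w w) s := by
    intro s hs
    have hfd : DifferentiableAt ℝ f (v + s • w) :=
      (hf.contDiffAt (hV.mem_nhds (hball (hseg s hs)).2)).differentiableAt (by simp)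
    have a1 : HasDerivAt (fun s : ℝ => v + s • w) w s := by
      simpa using ((hasDerivAt_id s).smul_const w).const_add v
    have a2 := hfd.hasFDerivAt.comp_hasDerivAt s a1
    have a3 : HasDerivAt (fun s : ℝ => s • fderiv ℝ f v w) (fderiv ℝ f v w) s := by
      simpa using (hasDerivAt_id s).smul_const (fderiv ℝ f v w)
    have a4 : HasDerivAt (fun s : ℝ => (s ^ 2 / 2) • fderiv ℝ (fderiv ℝ f) 0 w w)
        (s • fderiv ℝ (fderiv ℝ f) 0 w w) s := by
      have : HasDerivAt (fun s : ℝ => s ^ 2 / 2) s s := by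
        have := (hasDerivAt_pow 2 s).div_const 2
        have e : ((2 : ℕ) : ℝ) * s ^ (2 - 1) / 2 = s := by norm_num
        rw [e] at this
        exact this
      exact this.smul_const _
    exact (a2.sub a3).sub a4
  have hmv := norm_image_sub_le_of_norm_deriv_le_segment_01' (C := σ * ‖w‖ ^ 2)
    (fun s hs => (hd s hs).hasDerivWithinAt) (fun s hs => by
      have hs' : s ∈ Set.Icc (0:ℝ) 1 := ⟨hs.1, hs.2.le⟩
      have q := hU2 _ (hball (hseg s hs')).1 v (hball (by simpa using hv)).1
      simp only [add_sub_cancel_left, map_smul] at q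
      have e : fderiv ℝ f (v + s • w) w - fderiv ℝ f v w - s • fderiv ℝ (fderiv ℝ f) 0 w w =
        (fderiv ℝ f (v + s • w) - fderiv ℝ f v - s • fderiv ℝ (fderiv ℝ f) 0 w) w := by simp
      rw [e]
      refine (ContinuousLinearMap.le_opNorm _ _).trans ?_
      have : ‖s • w‖ ≤ ‖w‖ := by
        rw [norm_smul, Real.norm_eq_abs, abs_of_nonneg hs.1]
        exact mul_le_of_le_one_left (norm_nonneg _) hs.2.le
      have := q.trans (mul_le_mul_of_nonneg_left this hσ.le)
      calc _ ≤ (σ * ‖w‖) * ‖w‖ := mul_le_mul_of_nonneg_right this (norm_nonneg _)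
        _ = _ := by ring)
  convert hmv using 2
  simp
  abel

set_option maxHeartbeats 2000000 in
lemma pointwise_wave {V : Set X} (hV : IsOpen V) (h0 : (0 : X) ∈ V) {f : X → X}
    (hf : ContDiffOn ℝ ∞ f V) {Λ : X → ℝ} {r : X → X} (hΛ : ContDiffOn ℝ ∞ Λ V)
    (hr : ContDiffOn ℝ ∞ r V) (hr1 : ∀ v ∈ V, ‖r v‖ = 1)
    (heig : ∀ v ∈ V, fderiv ℝ f v (r v) = Λ v • r v) {s : X} {l' k μ β : ℝ}
    (hs : fderiv ℝ f 0 s = l' • s) (hβ : β * (l' - Λ 0) = -k / 4)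
    (hB : fderiv ℝ (fderiv ℝ f) 0 (r 0) (r 0) = k • s + μ • r 0) {σ : ℝ} (hσ : 0 < σ) :
    ∃ η > 0, ∃ K, 0 ≤ K ∧ Metric.ball 0 η ⊆ V ∧ |β| * η * ‖s‖ ≤ 1 ∧
      ∀ (u E : X) (a C : ℝ), ‖u‖ < η → |a| < η →
      |C| ≤ 1 → ‖E‖ < η →
      ‖f (u + ((a * C) • r u + (β * a ^ 2 * (2 * C ^ 2 - 1)) • s + E)) - f u
        - Λ u • ((a * C) • r u + (β * a ^ 2 * (2 * C ^ 2 - 1)) • s)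
        - (a ^ 2 / 4 * k) • s - (C ^ 2 * (a ^ 2 / 2) * μ) • r 0‖ ≤ σ * a ^ 2 + K * ‖E‖ := by
  set B := fderiv ℝ (fderiv ℝ f) 0 with hBd
  have hn0 := hV.mem_nhds h0
  set σ1 := min 1 (σ / (18 + |β| + 6 * ‖B‖ + 1)) with hsig_def
  have hσ1 : 0 < σ1 := by positivity
  have hσ1' : σ1 ≤ 1 := min_le_left _ _
  have hσ1'' : σ1 * (18 + |β| + 6 * ‖B‖) ≤ σ := by
    have := min_le_right 1 (σ / (18 + |β| + 6 * ‖B‖ + 1))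
    rw [← hsig_def, le_div_iff₀ (by positivity)] at this
    nlinarith
  obtain ⟨η1, hη1, hballV, htay⟩ := taylor2 hV h0 hf hσ1
  have hcdf : ContinuousAt (fderiv ℝ f) 0 :=
    ((hf.contDiffAt hn0).fderiv_right (m := ∞) (by simp)).continuousAt
  have hcr : ContinuousAt r 0 := (hr.contDiffAt hn0).continuousAt
  have hcL : ContinuousAt Λ 0 := (hΛ.contDiffAt hn0).continuousAt
  have hcT : ContinuousAt (fun u => fderiv ℝ f u s - Λ u • s) 0 :=
    (hcdf.clm_apply continuousAt_const).sub (hcL.smul continuousAt_const)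
  obtain ⟨η2, hη2, hT⟩ := Metric.continuousAt_iff.1 hcT σ1 hσ1
  obtain ⟨η3, hη3, hR⟩ := Metric.continuousAt_iff.1 hcr σ1 hσ1
  obtain ⟨η4, hη4, hD⟩ := Metric.continuousAt_iff.1 hcdf 1 one_pos
  set η := min (min (min η2 η3) (min η4 1)) (min (η1 / 5) (σ1 / (|β| * ‖s‖ + 1))) with hηd
  have hη : 0 < η := by positivity
  have g2 : η ≤ η2 := (min_le_left _ _).trans ((min_le_left _ _).trans (min_le_left _ _))
  have g3 : η ≤ η3 := (min_le_left _ _).trans ((min_le_left _ _).trans (min_le_right _ _))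
  have g4 : η ≤ η4 := (min_le_left _ _).trans ((min_le_right _ _).trans (min_le_left _ _))
  have g5 : η ≤ 1 := (min_le_left _ _).trans ((min_le_right _ _).trans (min_le_right _ _))
  have g1 : η ≤ η1 / 5 := (min_le_right _ _).trans (min_le_left _ _)
  have g6 : η * (|β| * ‖s‖) ≤ σ1 := by
    have : η ≤ σ1 / (|β| * ‖s‖ + 1) := (min_le_right _ _).trans (min_le_right _ _)
    rw [le_div_iff₀ (by positivity)] at this
    nlinarith
  refine ⟨η, hη, 2 + (‖fderiv ℝ f 0‖ + 1) + 2 * ‖B‖, by positivity,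
    (Metric.ball_subset_ball (by linarith)).trans hballV, by nlinarith, ?_⟩
  intro u E a C hu ha hC hE
  have huV : u ∈ V := hballV (by simp; linarith)
  have hT' : ‖fderiv ℝ f u s - Λ u • s - (l' - Λ 0) • s‖ ≤ σ1 := by
    have := hT (x := u) (by simpa using hu.trans_le g2)
    rw [dist_eq_norm, hs, ← sub_smul] at this
    exact this.le
  have hR' : ‖r u - r 0‖ ≤ σ1 := by
    have := hR (x := u) (by simpa using hu.trans_le g3)
    rw [dist_eq_norm] at this; exact this.le
  have hD' : ‖fderiv ℝ f u‖ ≤ ‖fderiv ℝ f 0‖ + 1 := by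
    have := hD (x := u) (by simpa using hu.trans_le g4)
    rw [dist_eq_norm] at this
    have := norm_le_norm_add_norm_sub' (fderiv ℝ f u) (fderiv ℝ f 0)
    linarith
  have hr0 : ‖r 0‖ = 1 := hr1 0 h0
  set b := β * a ^ 2 * (2 * C ^ 2 - 1) with hb
  have hC2 : C ^ 2 ≤ 1 := by rw [← sq_abs]; exact pow_le_one₀ (abs_nonneg _) hC
  have hb1 : |b| ≤ |β| * a ^ 2 := by
    rw [hb, abs_mul, abs_mul, abs_of_nonneg (sq_nonneg a)]
    have : |2 * C ^ 2 - 1| ≤ 1 := by rw [abs_le]; constructor <;> nlinarith [sq_nonneg C]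
    exact mul_le_of_le_one_right (by positivity) this
  set z := (a * C) • (r u - r 0) + b • s + E with hz
  have hzn : ‖z‖ ≤ 2 * σ1 * |a| + ‖E‖ := by
    have e1 : ‖(a * C) • (r u - r 0)‖ ≤ |a| * σ1 := by
      rw [norm_smul, Real.norm_eq_abs, abs_mul]
      exact mul_le_mul (mul_le_of_le_one_right (abs_nonneg _) hC) hR' (norm_nonneg _) (abs_nonneg _)
    have e2 : ‖b • s‖ ≤ |a| * σ1 := by
      rw [norm_smul, Real.norm_eq_abs]
      calc |b| * ‖s‖ ≤ |β| * a ^ 2 * ‖s‖ := mul_le_mul_of_nonneg_right hb1 (norm_nonneg _)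
        _ = |a| * (|a| * (|β| * ‖s‖)) := by rw [← sq_abs]; ring
        _ ≤ |a| * (η * (|β| * ‖s‖)) := by gcongr
        _ ≤ |a| * σ1 := by gcongr
    have := norm_add₃_le (a := (a * C) • (r u - r 0)) (b := b • s) (c := E)
    linarith
  set w := (a * C) • r u + b • s + E with hw
  have hwz : w = (a * C) • r 0 + z := by rw [hw, hz, smul_sub]; abel
  have hwn : ‖w‖ ≤ 3 * |a| + ‖E‖ := by
    rw [hwz]
    have e0 : ‖(a * C) • r 0‖ ≤ |a| := by
      rw [norm_smul, hr0, Real.norm_eq_abs, abs_mul, mul_one]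
      exact mul_le_of_le_one_right (abs_nonneg _) hC
    have := norm_add_le ((a * C) • r 0) z
    have := mul_le_mul_of_nonneg_right hσ1' (abs_nonneg a)
    linarith
  have hE1 : ‖E‖ ≤ 1 := hE.le.trans g5
  have hE2 : ‖E‖ ^ 2 ≤ ‖E‖ := by
    rw [sq]; exact mul_le_of_le_one_left (norm_nonneg _) hE1
  have hT1 := htay u w (by linarith) (by
    have := norm_add_le u w
    linarith)
  have hT1' : σ1 * ‖w‖ ^ 2 ≤ σ1 * (18 * a ^ 2 + 2 * ‖E‖) := by
    apply mul_le_mul_of_nonneg_left _ hσ1.le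
    have : ‖w‖ ^ 2 ≤ (3 * |a| + ‖E‖) ^ 2 := pow_le_pow_left₀ (norm_nonneg _) hwn 2
    nlinarith [sq_nonneg (3 * |a| - ‖E‖), sq_abs a]
  set T1 := f (u + w) - f u - fderiv ℝ f u w - (1 / 2 : ℝ) • B w w with hT1d
  set T2 := b • (fderiv ℝ f u s - Λ u • s - (l' - Λ 0) • s) with hT2d
  have hT2 : ‖T2‖ ≤ |β| * a ^ 2 * σ1 := by
    rw [hT2d, norm_smul, Real.norm_eq_abs]
    exact mul_le_mul hb1 hT' (norm_nonneg _) (by positivity)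
  set T3 := (1 / 2 : ℝ) • ((a * C) • (B (r 0) z + B z (r 0)) + B z z) with hT3d
  have hT3 : ‖T3‖ ≤ ‖B‖ * (6 * σ1 * a ^ 2 + 2 * ‖E‖) := by
    have q1 : ‖B (r 0) z‖ ≤ ‖B‖ * ‖z‖ := by
      have := B.le_opNorm₂ (r 0) z; rwa [hr0, mul_one] at this
    have q2 : ‖B z (r 0)‖ ≤ ‖B‖ * ‖z‖ := by
      have := B.le_opNorm₂ z (r 0); rwa [hr0, mul_one] at this
    have q3 : ‖B z z‖ ≤ ‖B‖ * ‖z‖ * ‖z‖ := B.le_opNorm₂ z z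
    have q4 : ‖(a * C) • (B (r 0) z + B z (r 0))‖ ≤ |a| * (‖B‖ * ‖z‖ + ‖B‖ * ‖z‖) := by
      rw [norm_smul, Real.norm_eq_abs, abs_mul]
      exact mul_le_mul (mul_le_of_le_one_right (abs_nonneg _) hC)
        ((norm_add_le _ _).trans (add_le_add q1 q2)) (norm_nonneg _) (abs_nonneg _)
    rw [hT3d, norm_smul]
    have q5 := norm_add_le ((a * C) • (B (r 0) z + B z (r 0))) (B z z)
    have q6 : ‖(1 / 2 : ℝ)‖ = 1 / 2 := by norm_num
    rw [q6]
    have q7 : 2 * (|a| * ‖z‖) + ‖z‖ * ‖z‖ ≤ 12 * σ1 * a ^ 2 + 4 * ‖E‖ := by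
      have i1 : |a| * ‖z‖ ≤ 2 * σ1 * a ^ 2 + ‖E‖ := by
        have := mul_le_mul_of_nonneg_left hzn (abs_nonneg a)
        have i : |a| * ‖E‖ ≤ ‖E‖ := mul_le_of_le_one_left (norm_nonneg _) (ha.le.trans g5)
        nlinarith [sq_abs a]
      have i2 : ‖z‖ * ‖z‖ ≤ 8 * σ1 * a ^ 2 + 2 * ‖E‖ := by
        have j1 : ‖z‖ * ‖z‖ ≤ (2 * σ1 * |a| + ‖E‖) ^ 2 := by
          rw [← sq]; exact pow_le_pow_left₀ (norm_nonneg _) hzn 2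
        have j2 : (σ1 * |a|) ^ 2 ≤ σ1 * a ^ 2 := by
          rw [mul_pow, sq_abs]
          apply mul_le_mul_of_nonneg_right _ (sq_nonneg a)
          nlinarith
        nlinarith [sq_nonneg (2 * σ1 * |a| - ‖E‖)]
      linarith
    have := mul_le_mul_of_nonneg_left q7 (norm_nonneg B)
    linarith
  have hT4 : ‖fderiv ℝ f u E‖ ≤ (‖fderiv ℝ f 0‖ + 1) * ‖E‖ :=
    (ContinuousLinearMap.le_opNorm _ _).trans (mul_le_mul_of_nonneg_right hD' (norm_nonneg _))
  have hBw : B w w = (a * C) ^ 2 • (k • s + μ • r 0) +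
      ((a * C) • (B (r 0) z + B z (r 0)) + B z z) := by
    rw [hwz, ← hB]
    simp only [map_add, map_smul, add_apply, smul_apply, smul_add, smul_smul]
    rw [pow_two]; abel
  have hDw : fderiv ℝ f u w = Λ u • (a * C) • r u + b • fderiv ℝ f u s + fderiv ℝ f u E := by
    rw [hw]; simp only [map_add, map_smul]; rw [heig u huV, smul_comm]
  have hmain : f (u + w) - f u - Λ u • ((a * C) • r u + b • s) - (a ^ 2 / 4 * k) • s -
      (C ^ 2 * (a ^ 2 / 2) * μ) • r 0 = T1 + T2 + T3 + fderiv ℝ f u E := by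
    have hbs : (b * (l' - Λ 0)) • s = (- (k / 4) * a ^ 2 * (2 * C ^ 2 - 1)) • s := by
      congr 1; rw [hb]; linear_combination (a ^ 2 * (2 * C ^ 2 - 1)) * hβ
    have e2 : T2 = b • fderiv ℝ f u s - (b * Λ u) • s - (- (k / 4) * a ^ 2 * (2 * C ^ 2 - 1)) • s := by
      rw [hT2d, ← hbs]; simp only [smul_sub, smul_smul]
    rw [e2, hT1d, hT3d, hDw, hBw]
    module
  rw [hmain]
  have e1 := norm_add_le (T1 + T2 + T3) (fderiv ℝ f u E)
  have e2 := norm_add₃_le (a := T1) (b := T2) (c := T3)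
  have e3 := mul_le_mul_of_nonneg_right hσ1'' (sq_nonneg a)
  have e4 := mul_le_mul_of_nonneg_right hσ1' (norm_nonneg E)
  linarith

end pointwise

section wave
variable {X : Type*} [NormedAddCommGroup X] [NormedSpace ℝ X]

lemma bdd_smooth {P : ℝ × ℝ → X} (hP : ContDiff ℝ ∞ P) (per : ∀ t x, P (t, x + 1) = P (t, x))
    (hz : ∀ t x, t < 1 ∨ 4 < t → P (t, x) = 0) :
    ∃ C, 0 ≤ C ∧ (∀ p, ‖P p‖ ≤ C) ∧ (∀ p, ‖dtt P p‖ ≤ C) ∧ ∀ p, ‖dxx P p‖ ≤ C := by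
  have per' : ∀ t x, P (t, x + 1) = P (t, x) + 0 := by simpa using per
  obtain ⟨C1, hC1, h1⟩ := bdd_of_per hP.continuous per hz
  obtain ⟨C2, hC2, h2⟩ := bdd_of_per hP.dtt.continuous (dtt_quasi per') (z := 0) (fun t x ht => by
      rw [dtt, fderiv_out (g' := fun _ => 0) hz t x ht]; simp)
  obtain ⟨C3, hC3, h3⟩ := bdd_of_per hP.dxx.continuous (dxx_quasi per') (z := 0) (fun t x ht => by
      rw [dxx, fderiv_out (g' := fun _ => 0) hz t x ht]; simp)
  refine ⟨C1 + C2 + C3, by positivity, fun p => ?_, fun p => ?_, fun p => ?_⟩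
  · linarith [h1 p]
  · linarith [h2 p]
  · linarith [h3 p]

lemma osc_deriv {φ : ℝ × ℝ → ℝ} {P Q : ℝ × ℝ → X} (hφ : ContDiff ℝ ∞ φ) (hP : ContDiff ℝ ∞ P)
    (hQ : ContDiff ℝ ∞ Q) {N : ℝ} (hN : 0 < N) (p v : ℝ × ℝ) :
    fderiv ℝ (fun p => (1 / N) • (Real.sin (N * φ p) • P p + Real.sin (2 * (N * φ p)) • Q p)) p v =
      (Real.cos (N * φ p) * fderiv ℝ φ p v) • P p +
      (2 * Real.cos (2 * (N * φ p)) * fderiv ℝ φ p v) • Q p +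
      (1 / N) • (Real.sin (N * φ p) • fderiv ℝ P p v + Real.sin (2 * (N * φ p)) • fderiv ℝ Q p v) := by
  have a1 := ((smooth_diff hφ p).hasFDerivAt.const_mul N)
  have a2 := a1.const_mul 2
  have b1 := a1.sin.smul (smooth_diff hP p).hasFDerivAt
  have b2 := a2.sin.smul (smooth_diff hQ p).hasFDerivAt
  have c := (b1.add b2).const_smul (1 / N)
  have c' : HasFDerivAt (fun p => (1 / N) • (Real.sin (N * φ p) • P p + Real.sin (2 * (N * φ p)) • Q p)) _ p := c
  rw [c'.fderiv]
  have hN' : N⁻¹ * N = 1 := inv_mul_cancel₀ hN.ne'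
  simp only [smul_apply, add_apply, ContinuousLinearMap.smulRight_apply, smul_add, smul_smul, smul_eq_mul, one_div]
  have e1 : N⁻¹ * (Real.cos (N * φ p) * N * fderiv ℝ φ p v) = Real.cos (N * φ p) * fderiv ℝ φ p v := by
    linear_combination (Real.cos (N * φ p) * fderiv ℝ φ p v) * hN'
  have e2 : N⁻¹ * (Real.cos (2 * (N * φ p)) * (2 * N) * fderiv ℝ φ p v) =
      2 * Real.cos (2 * (N * φ p)) * fderiv ℝ φ p v := by
    linear_combination (2 * Real.cos (2 * (N * φ p)) * fderiv ℝ φ p v) * hN'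
  rw [e1, e2]
  abel

set_option maxHeartbeats 1000000 in
lemma wave_step {V : Set X} (hV : IsOpen V) (h0 : (0 : X) ∈ V) {f : X → X}
    (hf : ContDiffOn ℝ ∞ f V) {Λ : X → ℝ} {r : X → X} (hΛ : ContDiffOn ℝ ∞ Λ V)
    (hr : ContDiffOn ℝ ∞ r V) (hr1 : ∀ v ∈ V, ‖r v‖ = 1)
    (heig : ∀ v ∈ V, fderiv ℝ f v (r v) = Λ v • r v) {s : X} {l' k μ : ℝ}
    (hs : fderiv ℝ f 0 s = l' • s) (hne : l' ≠ Λ 0)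
    (hB : fderiv ℝ (fderiv ℝ f) 0 (r 0) (r 0) = k • s + μ • r 0) {σ : ℝ} (hσ : 0 < σ) :
    ∃ η > 0, Metric.ball 0 η ⊆ V ∧ ∀ (c : X) (ψ : ℝ × ℝ → X) (a : ℝ × ℝ → ℝ) (τ : ℝ), 0 < τ →
      ContDiff ℝ ∞ ψ → (∀ t x, ψ (t, x + 1) = ψ (t, x) + c) → (∀ p, ‖dxx ψ p‖ < η) →
      (∀ t x, t < 1 ∨ 4 < t → dxx ψ (t, x) = c) →
      ContDiff ℝ ∞ a → (∀ t x, a (t, x + 1) = a (t, x)) → (∀ t x, t < 1 ∨ 4 < t → a (t, x) = 0) →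
      (∀ p, |a p| < η) →
      ∃ ψ' : ℝ × ℝ → X, ContDiff ℝ ∞ ψ' ∧ (∀ t x, ψ' (t, x + 1) = ψ' (t, x) + c) ∧
        (∀ p, a p = 0 → ψ' p = ψ p) ∧ (∀ p, ‖ψ' p - ψ p‖ ≤ τ) ∧
        (∀ p, ‖dxx ψ' p - dxx ψ p‖ ≤ 2 * |a p| + τ) ∧
        ∀ p, ∃ q : ℝ, 0 ≤ q ∧ q ≤ 1 ∧ ‖(dtt ψ' p + f (dxx ψ' p)) - (dtt ψ p + f (dxx ψ p))
          - (a p ^ 2 / 4 * k) • s - (q * (a p ^ 2 / 2) * μ) • r 0‖ ≤ σ * a p ^ 2 + τ := by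
  have hne' : l' - Λ 0 ≠ 0 := sub_ne_zero.2 hne
  set β := -k / 4 / (l' - Λ 0) with hβd
  have hβ : β * (l' - Λ 0) = -k / 4 := by rw [hβd]; field_simp
  obtain ⟨η, hη, K, hK, hball, hβη, hpt⟩ :=
    pointwise_wave hV h0 hf hΛ hr hr1 heig hs hβ hB hσ
  refine ⟨η, hη, hball, ?_⟩
  intro c ψ a τ hτ hψ hquasi hsmall hout ha haper haout hasmall
  have huV : ∀ p, dxx ψ p ∈ V := fun p => hball (by simpa using hsmall p)
  have hΛu : ContDiff ℝ ∞ (fun p => Λ (dxx ψ p)) := hΛ.comp_contDiff hψ.dxx huV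
  have hru : ContDiff ℝ ∞ (fun p => r (dxx ψ p)) := hr.comp_contDiff hψ.dxx huV
  have huper := dxx_quasi hquasi
  obtain ⟨φ, hφ, hφper, hφpos, hφerr⟩ := exists_phase hΛu (fun t x => by simp only [huper])
    (l0 := Λ c) (fun t x ht => by simp only [hout t x ht])
    (τ := τ / 2 / (2 * η)) (by positivity)
  have hφx := hφ.dxx
  have hg : ContDiff ℝ ∞ (fun p => (dxx φ p)⁻¹) := hφx.inv (fun p => (hφpos p).ne')
  have hφxper := dxx_quasi hφper
  set P : ℝ × ℝ → X := fun p => (a p * (dxx φ p)⁻¹) • r (dxx ψ p) with hPd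
  set Q : ℝ × ℝ → X := fun p => (β / 2 * a p ^ 2 * (dxx φ p)⁻¹) • s with hQd
  have hP : ContDiff ℝ ∞ P := (ha.mul hg).smul hru
  have hQ : ContDiff ℝ ∞ Q := ((contDiff_const.mul (ha.pow 2)).mul hg).smul contDiff_const
  have hPper : ∀ t x, P (t, x + 1) = P (t, x) := fun t x => by simp only [hPd, huper, haper, hφxper]
  have hQper : ∀ t x, Q (t, x + 1) = Q (t, x) := fun t x => by simp only [hQd, haper, hφxper]
  obtain ⟨C1, hC1, hP0, hPt, hPx⟩ := bdd_smooth hP hPper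
    (fun t x ht => by simp [hPd, haout t x ht])
  obtain ⟨C2, hC2, hQ0, hQt, hQx⟩ := bdd_smooth hQ hQper
    (fun t x ht => by simp [hQd, haout t x ht])
  set ς := min (η / 2) (min (τ / 4) (τ / (4 * (K + 1)))) with hςd
  have hς : 0 < ς := by positivity
  have hς1 : ς < η := (min_le_left _ _).trans_lt (by linarith)
  have hς2 : ς ≤ τ / 4 := (min_le_right _ _).trans (min_le_left _ _)
  have hς3 : K * ς ≤ τ / 4 := by
    have : ς ≤ τ / (4 * (K + 1)) := (min_le_right _ _).trans (min_le_right _ _)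
    rw [le_div_iff₀ (by positivity)] at this
    nlinarith
  obtain ⟨N, hN⟩ := exists_nat_gt ((C1 + C2) / ς)
  have hN0 : (0 : ℝ) < N := lt_of_le_of_lt (by positivity) hN
  rw [div_lt_iff₀ hς] at hN
  have hNb : ∀ (x y : ℝ) (v w : X), |x| ≤ 1 → |y| ≤ 1 → ‖v‖ ≤ C1 → ‖w‖ ≤ C2 →
      ‖(1 / (N : ℝ)) • (x • v + y • w)‖ ≤ ς := by
    intro x y v w hx hy hv hw
    rw [norm_smul, Real.norm_eq_abs, abs_of_pos (by positivity), one_div_mul_eq_div, div_le_iff₀ hN0]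
    have e1 : ‖x • v‖ ≤ C1 := by
      rw [norm_smul]; exact (mul_le_of_le_one_left (norm_nonneg _) hx).trans hv
    have e2 : ‖y • w‖ ≤ C2 := by
      rw [norm_smul]; exact (mul_le_of_le_one_left (norm_nonneg _) hy).trans hw
    have := norm_add_le (x • v) (y • w)
    linarith
  set W : ℝ × ℝ → X := fun p =>
    (1 / (N : ℝ)) • (Real.sin (N * φ p) • P p + Real.sin (2 * (N * φ p)) • Q p) with hWd
  have hW : ContDiff ℝ ∞ W := by
    apply contDiff_const.smul
    exact ((Real.contDiff_sin.comp (contDiff_const.mul hφ)).smul hP).add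
      ((Real.contDiff_sin.comp (contDiff_const.mul (contDiff_const.mul hφ))).smul hQ)
  have hWper : ∀ t x, W (t, x + 1) = W (t, x) := by
    intro t x
    simp only [hWd, hPper, hQper, hφper]
    have e1 : (N : ℝ) * (φ (t, x) + 2 * Real.pi) = N * φ (t, x) + N * (2 * Real.pi) := by ring
    have e2 : 2 * ((N : ℝ) * (φ (t, x) + 2 * Real.pi)) =
        2 * (N * φ (t, x)) + ((2 * N : ℕ) : ℝ) * (2 * Real.pi) := by push_cast; ring
    rw [e2, e1, Real.sin_add_nat_mul_two_pi, Real.sin_add_nat_mul_two_pi]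
  have hsplit : ∀ p v, fderiv ℝ (fun p => ψ p + W p) p v = fderiv ℝ ψ p v + fderiv ℝ W p v := by
    intro p v
    have : HasFDerivAt (fun p => ψ p + W p) (fderiv ℝ ψ p + fderiv ℝ W p) p :=
      (smooth_diff hψ p).hasFDerivAt.add (smooth_diff hW p).hasFDerivAt
    rw [this.fderiv]; rfl
  -- the leading part of the perturbation
  set w0 : ℝ × ℝ → X := fun p => (a p * Real.cos (N * φ p)) • r (dxx ψ p) +
    (β * a p ^ 2 * (2 * Real.cos (N * φ p) ^ 2 - 1)) • s with hw0
  set Ex : ℝ × ℝ → X := fun p => (1 / (N : ℝ)) • (Real.sin (N * φ p) • dxx P p +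
    Real.sin (2 * (N * φ p)) • dxx Q p) with hEx
  set Et : ℝ × ℝ → X := fun p => (1 / (N : ℝ)) • (Real.sin (N * φ p) • dtt P p +
    Real.sin (2 * (N * φ p)) • dtt Q p) with hEt
  have hExb : ∀ p, ‖Ex p‖ ≤ ς := fun p =>
    hNb _ _ _ _ (Real.abs_sin_le_one _) (Real.abs_sin_le_one _) (hPx p) (hQx p)
  have hEtb : ∀ p, ‖Et p‖ ≤ ς := fun p =>
    hNb _ _ _ _ (Real.abs_sin_le_one _) (Real.abs_sin_le_one _) (hPt p) (hQt p)
  have hlead : ∀ p (m : ℝ), (Real.cos (N * φ p) * m) • P p +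
      (2 * Real.cos (2 * (N * φ p)) * m) • Q p = (m * (dxx φ p)⁻¹) • w0 p := by
    intro p m
    simp only [hPd, hQd, hw0, Real.cos_two_mul]
    module
  have hdx : ∀ p, dxx (fun p => ψ p + W p) p = dxx ψ p + (w0 p + Ex p) := by
    intro p
    have h1 := osc_deriv hφ hP hQ hN0 p ((0, 1) : ℝ × ℝ)
    rw [hlead] at h1
    have e : fderiv ℝ φ p (0, 1) * (dxx φ p)⁻¹ = 1 := mul_inv_cancel₀ (hφpos p).ne'
    rw [e, one_smul] at h1
    rw [dxx, hsplit, h1]; rfl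
  have hdt : ∀ p, dtt (fun p => ψ p + W p) p =
      dtt ψ p + ((dtt φ p * (dxx φ p)⁻¹) • w0 p + Et p) := by
    intro p
    have h1 := osc_deriv hφ hP hQ hN0 p ((1, 0) : ℝ × ℝ)
    rw [hlead] at h1
    rw [dtt, hsplit, h1]; rfl
  have hw0n : ∀ p, ‖w0 p‖ ≤ 2 * |a p| := by
    intro p
    have hC := Real.abs_cos_le_one (N * φ p)
    have e1 : ‖(a p * Real.cos (N * φ p)) • r (dxx ψ p)‖ ≤ |a p| := by
      rw [norm_smul, hr1 _ (huV p), mul_one, Real.norm_eq_abs, abs_mul]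
      exact mul_le_of_le_one_right (abs_nonneg _) hC
    have e2 : ‖(β * a p ^ 2 * (2 * Real.cos (N * φ p) ^ 2 - 1)) • s‖ ≤ |a p| := by
      rw [← Real.cos_two_mul, norm_smul, Real.norm_eq_abs, abs_mul, abs_mul, abs_of_nonneg (sq_nonneg (a p)), ← sq_abs]
      have hC' := Real.abs_cos_le_one (2 * (N * φ p))
      have i1 : |β| * |a p| * ‖s‖ ≤ 1 := le_trans (by gcongr; exact (hasmall p).le) hβη
      calc |β| * |a p| ^ 2 * |Real.cos (2 * (N * φ p))| * ‖s‖
          ≤ |β| * |a p| ^ 2 * 1 * ‖s‖ := by gcongr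
        _ = |a p| * (|β| * |a p| * ‖s‖) := by ring
        _ ≤ |a p| * 1 := by gcongr
        _ = |a p| := mul_one _
    have := norm_add_le ((a p * Real.cos (N * φ p)) • r (dxx ψ p))
      ((β * a p ^ 2 * (2 * Real.cos (N * φ p) ^ 2 - 1)) • s)
    simp only [hw0]
    linarith
  refine ⟨fun p => ψ p + W p, hψ.add hW, ?_, ?_, ?_, ?_, ?_⟩
  · intro t x; simp only [hquasi, hWper]; abel
  · intro p hp; simp [hWd, hPd, hQd, hp]
  · intro p
    rw [add_sub_cancel_left]
    have := hNb _ _ _ _ (Real.abs_sin_le_one (N * φ p)) (Real.abs_sin_le_one (2 * (N * φ p))) (hP0 p) (hQ0 p)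
    exact this.trans (by linarith)
  · intro p
    rw [hdx, add_sub_cancel_left]
    have := norm_add_le (w0 p) (Ex p)
    linarith [hw0n p, hExb p]
  · intro p
    refine ⟨Real.cos (N * φ p) ^ 2, sq_nonneg _, Real.cos_sq_le_one _, ?_⟩
    rw [hdx, hdt]
    have hm := hpt (dxx ψ p) (Ex p) (a p) (Real.cos (N * φ p)) (hsmall p) (hasmall p)
      (Real.abs_cos_le_one _) ((hExb p).trans_lt hς1)
    have hph : ‖(dtt φ p * (dxx φ p)⁻¹ + Λ (dxx ψ p)) • w0 p‖ ≤ τ / 2 := by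
      obtain ⟨t, x⟩ := p
      rcases le_or_gt t 4 with ht | ht
      · have h1 := hφerr t x ht
        have hp := hφpos (t, x)
        have h2 : |dtt φ (t, x) * (dxx φ (t, x))⁻¹ + Λ (dxx ψ (t, x))| ≤ τ / 2 / (2 * η) := by
          have e : dtt φ (t, x) * (dxx φ (t, x))⁻¹ + Λ (dxx ψ (t, x)) =
            (dtt φ (t, x) + Λ (dxx ψ (t, x)) * dxx φ (t, x)) / dxx φ (t, x) := by
            field_simp
          rw [e, abs_div, abs_of_pos hp, div_le_iff₀ hp]
          exact h1
        rw [norm_smul]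
        have h3 : ‖w0 (t, x)‖ ≤ 2 * η := (hw0n (t, x)).trans (by linarith [hasmall (t, x)])
        calc _ ≤ τ / 2 / (2 * η) * (2 * η) := mul_le_mul h2 h3 (norm_nonneg _) (by positivity)
          _ = τ / 2 := by field_simp
      · have : w0 (t, x) = 0 := by simp [hw0, haout t x (Or.inr ht)]
        rw [this, smul_zero, norm_zero]; positivity
    have e : dtt ψ p + ((dtt φ p * (dxx φ p)⁻¹) • w0 p + Et p) + f (dxx ψ p + (w0 p + Ex p)) -
        (dtt ψ p + f (dxx ψ p)) - (a p ^ 2 / 4 * k) • s -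
        (Real.cos (N * φ p) ^ 2 * (a p ^ 2 / 2) * μ) • r 0 =
        (f (dxx ψ p + (w0 p + Ex p)) - f (dxx ψ p) - Λ (dxx ψ p) • w0 p - (a p ^ 2 / 4 * k) • s -
        (Real.cos (N * φ p) ^ 2 * (a p ^ 2 / 2) * μ) • r 0) +
        (dtt φ p * (dxx φ p)⁻¹ + Λ (dxx ψ p)) • w0 p + Et p := by
      module
    rw [e]
    have hm' : ‖f (dxx ψ p + (w0 p + Ex p)) - f (dxx ψ p) - Λ (dxx ψ p) • w0 p - (a p ^ 2 / 4 * k) • s -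
        (Real.cos (N * φ p) ^ 2 * (a p ^ 2 / 2) * μ) • r 0‖ ≤ σ * a p ^ 2 + K * ‖Ex p‖ := hm
    refine (norm_add₃_le).trans ?_
    have := mul_le_mul_of_nonneg_left (hExb p) hK
    linarith [hEtb p]

end wave

lemma eigen_second {X : Type*} [NormedAddCommGroup X] [NormedSpace ℝ X] {V : Set X} (hV : IsOpen V)
    (h0 : (0 : X) ∈ V) {f : X → X}
    (hf : ContDiffOn ℝ ∞ f V) {Λ : X → ℝ} {r : X → X} (hΛ : ContDiffOn ℝ ∞ Λ V)
    (hr : ContDiffOn ℝ ∞ r V) (heig : ∀ v ∈ V, fderiv ℝ f v (r v) = Λ v • r v) :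
    fderiv ℝ (fderiv ℝ f) 0 (r 0) (r 0) = (fderiv ℝ Λ 0 (r 0)) • r 0 + Λ 0 • fderiv ℝ r 0 (r 0)
      - fderiv ℝ f 0 (fderiv ℝ r 0 (r 0)) := by
  have hn := hV.mem_nhds h0
  have dΛ : HasFDerivAt Λ (fderiv ℝ Λ 0) 0 :=
    ((hΛ.contDiffAt hn).differentiableAt (by simp)).hasFDerivAt
  have dr : HasFDerivAt r (fderiv ℝ r 0) 0 :=
    ((hr.contDiffAt hn).differentiableAt (by simp)).hasFDerivAt
  have df : HasFDerivAt (fderiv ℝ f) (fderiv ℝ (fderiv ℝ f) 0) 0 :=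
    (((hf.contDiffAt hn).fderiv_right (m := ∞) (by simp)).differentiableAt (by simp)).hasFDerivAt
  have h1 := df.clm_apply dr
  have h2 := dΛ.smul dr
  have he : (fun v => fderiv ℝ f v (r v)) =ᶠ[nhds 0] fun v => Λ v • r v := by
    filter_upwards [hn] with v hv using heig v hv
  have h3 := (h2.congr_of_eventuallyEq he).unique h1
  have h4 := congrArg (fun T => T (r 0)) h3
  simp at h4
  rw [eq_sub_iff_add_eq, add_comm, ← h4]
  abel

lemma dot2_add (l a b : E2) : dot2 l (a + b) = dot2 l a + dot2 l b := by simp [dot2]; ring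
lemma dot2_sub (l a b : E2) : dot2 l (a - b) = dot2 l a - dot2 l b := by simp [dot2]; ring
lemma dot2_smul (l a : E2) (c : ℝ) : dot2 l (c • a) = c * dot2 l a := by simp [dot2]; ring
lemma dot2_comm (l a : E2) : dot2 l a = dot2 a l := by simp [dot2]; ring

/-- `dot2 l` as a continuous linear functional -/
def dotL (l : E2) : E2 →L[ℝ] ℝ :=
  LinearMap.toContinuousLinearMap
    { toFun := dot2 l
      map_add' := dot2_add l
      map_smul' := fun c a => dot2_smul l a c }

lemma dotL_apply (l a : E2) : dotL l a = dot2 l a := rfl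

lemma basis2 {lm lp a b : E2} (h1 : dot2 lm a = 1) (h2 : dot2 lm b = 0) (h3 : dot2 lp a = 0)
    (h4 : dot2 lp b = 1) (w : E2) : w = dot2 lm w • a + dot2 lp w • b := by
  simp only [dot2] at *
  have hd : (lm 0 * lp 1 - lm 1 * lp 0) * (a 0 * b 1 - a 1 * b 0) = 1 := by
    linear_combination h1 * (lp 0 * b 0 + lp 1 * b 1) + h4 - (lm 0 * b 0 + lm 1 * b 1) * h3
  have hd' : lm 0 * lp 1 - lm 1 * lp 0 ≠ 0 := left_ne_zero_of_mul_eq_one hd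
  ext i
  fin_cases i
  · apply mul_left_cancel₀ hd'
    simp [-mul_eq_mul_left_iff]
    linear_combination (-lp 1 * (lm 0 * w 0 + lm 1 * w 1)) * h1 + (lm 1 * (lp 0 * w 0 + lp 1 * w 1)) * h4 + (lm 1 * (lm 0 * w 0 + lm 1 * w 1)) * h3 - (lp 1 * (lp 0 * w 0 + lp 1 * w 1)) * h2
  · apply mul_left_cancel₀ hd'
    simp [-mul_eq_mul_left_iff]
    linear_combination (lp 0 * (lm 0 * w 0 + lm 1 * w 1)) * h1 - (lm 0 * (lp 0 * w 0 + lp 1 * w 1)) * h4 - (lm 0 * (lm 0 * w 0 + lm 1 * w 1)) * h3 + (lp 0 * (lp 0 * w 0 + lp 1 * w 1)) * h2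

/-- `B(r,r)` in the eigenbasis -/
lemma second_expand {V : Set E2} (hV : IsOpen V)
    (h0 : (0 : E2) ∈ V) {f : E2 → E2}
    (hf : ContDiffOn ℝ ∞ f V) {Λ : E2 → ℝ} {r : E2 → E2} (hΛ : ContDiffOn ℝ ∞ Λ V)
    (hr : ContDiffOn ℝ ∞ r V) (heig : ∀ v ∈ V, fderiv ℝ f v (r v) = Λ v • r v)
    {l l' s : E2} {ν : ℝ} (hl : ∀ w, dot2 l (fderiv ℝ f 0 w) = Λ 0 * dot2 l w)
    (hl' : ∀ w, dot2 l' (fderiv ℝ f 0 w) = ν * dot2 l' w)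
    (h1 : dot2 l (r 0) = 1) (h2 : dot2 l s = 0) (h3 : dot2 l' (r 0) = 0) (h4 : dot2 l' s = 1) :
    fderiv ℝ (fderiv ℝ f) 0 (r 0) (r 0) =
      ((Λ 0 - ν) * dot2 l' (fderiv ℝ r 0 (r 0))) • s + (fderiv ℝ Λ 0 (r 0)) • r 0 := by
  have e := eigen_second hV h0 hf hΛ hr heig
  have e1 := basis2 h1 h2 h3 h4 (fderiv ℝ (fderiv ℝ f) 0 (r 0) (r 0))
  rw [e1]
  have a1 : dot2 l (fderiv ℝ (fderiv ℝ f) 0 (r 0) (r 0)) = fderiv ℝ Λ 0 (r 0) := by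
    rw [e, dot2_sub, dot2_add, dot2_smul, dot2_smul, hl, h1]; ring
  have a2 : dot2 l' (fderiv ℝ (fderiv ℝ f) 0 (r 0) (r 0)) =
      (Λ 0 - ν) * dot2 l' (fderiv ℝ r 0 (r 0)) := by
    rw [e, dot2_sub, dot2_add, dot2_smul, dot2_smul, hl', h3]; ring
  rw [a1, a2, add_comm]

section step
variable {X : Type*} [NormedAddCommGroup X] [NormedSpace ℝ X]

/-- conclusion of `wave_step` -/
def WaveProp (f : X → X) (s r0 : X) (k μ σ η : ℝ) : Prop :=
  ∀ (c : X) (ψ : ℝ × ℝ → X) (a : ℝ × ℝ → ℝ) (τ : ℝ), 0 < τ →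
      ContDiff ℝ ∞ ψ → (∀ t x, ψ (t, x + 1) = ψ (t, x) + c) → (∀ p, ‖dxx ψ p‖ < η) →
      (∀ t x, t < 1 ∨ 4 < t → dxx ψ (t, x) = c) →
      ContDiff ℝ ∞ a → (∀ t x, a (t, x + 1) = a (t, x)) → (∀ t x, t < 1 ∨ 4 < t → a (t, x) = 0) →
      (∀ p, |a p| < η) →
      ∃ ψ' : ℝ × ℝ → X, ContDiff ℝ ∞ ψ' ∧ (∀ t x, ψ' (t, x + 1) = ψ' (t, x) + c) ∧
        (∀ p, a p = 0 → ψ' p = ψ p) ∧ (∀ p, ‖ψ' p - ψ p‖ ≤ τ) ∧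
        (∀ p, ‖dxx ψ' p - dxx ψ p‖ ≤ 2 * |a p| + τ) ∧
        ∀ p, ∃ q : ℝ, 0 ≤ q ∧ q ≤ 1 ∧ ‖(dtt ψ' p + f (dxx ψ' p)) - (dtt ψ p + f (dxx ψ p))
          - (a p ^ 2 / 4 * k) • s - (q * (a p ^ 2 / 2) * μ) • r0‖ ≤ σ * a p ^ 2 + τ

lemma WaveProp.mono {f : X → X} {s r0 : X} {k μ σ η η' : ℝ} (h : WaveProp f s r0 k μ σ η)
    (hη : η' ≤ η) : WaveProp f s r0 k μ σ η' := by
  intro c ψ a τ hτ h1 h2 h3 h4 h5 h6 h7 h8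
  exact h c ψ a τ hτ h1 h2 (fun p => (h3 p).trans_le hη) h4 h5 h6 h7 (fun p => (h8 p).trans_le hη)

/-- an approximate solution (subsolution) -/
structure IsState (f : X → X) (Lm Lp : X →L[ℝ] ℝ) (km kp δ α β : ℝ) (c : X) (ψ : ℝ × ℝ → X) :
    Prop where
  smooth : ContDiff ℝ ∞ ψ
  quasi : ∀ t x, ψ (t, x + 1) = ψ (t, x) + c
  outx : ∀ t x, t < α ∨ β < t → dxx ψ (t, x) = c
  outt : ∀ t x, t < α ∨ β < t → dtt ψ (t, x) + f c = 0
  bm : ∀ p, |Lm (dtt ψ p + f (dxx ψ p))| ≤ kp * δ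
  bp : ∀ p, |Lp (dtt ψ p + f (dxx ψ p))| ≤ km * δ

lemma exists_cutoff {α β α' β' : ℝ} (h1 : α' < α) (h2 : β < β') :
    ∃ χ : ℝ → ℝ, ContDiff ℝ ∞ χ ∧ (∀ t, 0 ≤ χ t) ∧ (∀ t, χ t ≤ 1) ∧
      (∀ t, α ≤ t → t ≤ β → χ t = 1) ∧ (∀ t, t < α' ∨ β' < t → χ t = 0) := by
  refine ⟨fun t => Real.smoothTransition ((t - α') / (α - α')) *
    Real.smoothTransition ((β' - t) / (β' - β)), ?_, ?_, ?_, ?_, ?_⟩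
  · exact (Real.smoothTransition.contDiff.comp ((contDiff_id.sub contDiff_const).div_const _)).mul
      (Real.smoothTransition.contDiff.comp ((contDiff_const.sub contDiff_id).div_const _))
  · intro t
    exact mul_nonneg (Real.smoothTransition.nonneg _) (Real.smoothTransition.nonneg _)
  · intro t
    exact mul_le_one₀ (Real.smoothTransition.le_one _) (Real.smoothTransition.nonneg _)
      (Real.smoothTransition.le_one _)
  · intro t h3 h4
    simp only
    rw [Real.smoothTransition.one_of_one_le, Real.smoothTransition.one_of_one_le, mul_one]
    · rw [le_div_iff₀ (by linarith)]; linarith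
    · rw [le_div_iff₀ (by linarith)]; linarith
  · rintro t (ht | ht)
    · simp only
      rw [Real.smoothTransition.zero_of_nonpos, zero_mul]
      exact div_nonpos_of_nonpos_of_nonneg (by linarith) (by linarith)
    · simp only
      rw [Real.smoothTransition.zero_of_nonpos (x := (β' - t) / (β' - β)), mul_zero]
      exact div_nonpos_of_nonpos_of_nonneg (by linarith) (by linarith)

/-- amplitude functions -/
lemma exists_amp {χ : ℝ → ℝ} (hχ : ContDiff ℝ ∞ χ) (h0 : ∀ t, 0 ≤ χ t) (h1 : ∀ t, χ t ≤ 1)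
    {e : ℝ × ℝ → ℝ} (he : ContDiff ℝ ∞ e) (heper : ∀ t x, e (t, x + 1) = e (t, x))
    {δ : ℝ} (hδ : 0 < δ) (hb : ∀ p, |e p| ≤ δ) (hz : ∀ t x, χ t ≠ 1 → e (t, x) = 0) :
    ∃ a : ℝ × ℝ → ℝ, ContDiff ℝ ∞ a ∧ (∀ t x, a (t, x + 1) = a (t, x)) ∧
      (∀ t x, χ t = 0 → a (t, x) = 0) ∧ (∀ p, a p ^ 2 / 4 = 2 * δ * χ p.1 ^ 2 - e p) ∧
      (∀ p, a p ^ 2 ≤ 12 * δ) ∧ ∀ p, |a p| ≤ 4 * √δ := by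
  have hpos : ∀ p, 0 < 4 * (2 * δ - e p) := fun p => by
    have := abs_le.1 (hb p); linarith
  set a : ℝ × ℝ → ℝ := fun p => χ p.1 * √(4 * (2 * δ - e p)) with had
  have hsq : ∀ p, a p ^ 2 = χ p.1 ^ 2 * (4 * (2 * δ - e p)) := by
    intro p
    simp only [had]
    rw [mul_pow, Real.sq_sqrt (hpos p).le]
  have hle : ∀ p, a p ^ 2 ≤ 12 * δ := by
    intro p
    rw [hsq]
    have h2 : χ p.1 ^ 2 ≤ 1 := pow_le_one₀ (h0 _) (h1 _)
    have h3 := abs_le.1 (hb p)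
    have := mul_le_mul_of_nonneg_right h2 (hpos p).le
    linarith
  refine ⟨a, ?_, ?_, ?_, ?_, hle, ?_⟩
  · apply ContDiff.mul (hχ.comp contDiff_fst)
    apply ContDiff.sqrt (contDiff_const.mul (contDiff_const.sub he))
    exact fun p => (hpos p).ne'
  · intro t x; simp only [had, heper]
  · intro t x h; simp [had, h]
  · rintro ⟨t, x⟩
    rw [hsq]
    by_cases h : χ t = 1
    · simp only [h]; ring
    · rw [hz t x h]; ring
  · intro p
    have h4 : |a p| ≤ √(12 * δ) := Real.abs_le_sqrt (hle p)
    refine h4.trans ?_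
    rw [Real.sqrt_le_iff]
    refine ⟨by positivity, ?_⟩
    rw [mul_pow, Real.sq_sqrt hδ.le]; linarith

set_option maxHeartbeats 1000000 in
lemma state_step {V : Set X} {f : X → X} (hf : ContDiffOn ℝ ∞ f V) {η : ℝ} (hη : 0 < η)
    (hball : Metric.ball 0 η ⊆ V) {em ep : X} {Lm Lp : X →L[ℝ] ℝ}
    (h11 : Lm em = 1) (h12 : Lm ep = 0) (h21 : Lp em = 0) (h22 : Lp ep = 1)
    {km kp μm μp σ C : ℝ} (hkm : 0 < km) (hkp : 0 < kp)
    (hμp : |μp| ≤ 1 / 100 * km) (hμm : |μm| ≤ 1 / 100 * kp) (hσ0 : 0 < σ) (hC : 0 < C)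
    (hCm : ∀ w, |Lm w| ≤ C * ‖w‖) (hCp : ∀ w, |Lp w| ≤ C * ‖w‖)
    (hσ1 : 24 * σ * C ≤ kp / 16) (hσ2 : 24 * σ * C ≤ km / 16)
    (Wp : WaveProp f em ep kp μp σ η) (Wm : WaveProp f ep em (-km) μm σ η)
    {c : X} {ψ : ℝ × ℝ → X} {δ α β α' β' θ : ℝ} (hδ : 0 < δ) (hδη : 20 * √δ < η)
    (hα' : 1 ≤ α') (hα : α' < α) (hβ : β < β') (hβ' : β' ≤ 4)
    (S : IsState f Lm Lp km kp δ α β c ψ) (hsmall : ∀ p, ‖dxx ψ p‖ < η / 2) (hθ : 0 < θ) :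
    ∃ ψ', IsState f Lm Lp km kp (δ / 4) α' β' c ψ' ∧
      (∀ p, ‖dxx ψ' p - dxx ψ p‖ ≤ 20 * √δ) ∧
      ∀ t x, ‖(ψ' (t, x) - ψ' (t, 0)) - (ψ (t, x) - ψ (t, 0))‖ ≤ θ := by
  have hψ := S.smooth
  have hquasi := S.quasi
  have hsq : 0 < √δ := Real.sqrt_pos.2 hδ
  obtain ⟨χ, hχ, hχ0, hχ1, hχone, hχout⟩ := exists_cutoff hα hβ
  have hχne : ∀ t, χ t ≠ 1 → t < α ∨ β < t := by
    intro t h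
    by_contra hh
    push Not at hh
    exact h (hχone t hh.1 hh.2)
  have huV : ∀ p, dxx ψ p ∈ V := fun p => hball (by
    rw [mem_ball_zero_iff]; linarith [hsmall p])
  set D : ℝ × ℝ → X := fun p => dtt ψ p + f (dxx ψ p) with hDd
  have hD : ContDiff ℝ ∞ D := hψ.dtt.add (hf.comp_contDiff hψ.dxx huV)
  have hDper : ∀ t x, D (t, x + 1) = D (t, x) := fun t x => by
    simp only [hDd, dtt_quasi hquasi, dxx_quasi hquasi]
  have hDz : ∀ t x, χ t ≠ 1 → D (t, x) = 0 := by
    intro t x h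
    simp only [hDd]
    rw [S.outx t x (hχne t h), S.outt t x (hχne t h)]
  -- amplitudes
  obtain ⟨ap, hap, happer, hapz, hapsq, haple, hapb⟩ := exists_amp hχ hχ0 hχ1
    (e := fun p => Lm (D p) / kp) ((Lm.contDiff.comp hD).div_const _)
    (fun t x => by simp only [hDper]) hδ
    (fun p => by rw [abs_div, abs_of_pos hkp, div_le_iff₀ hkp, mul_comm]; exact S.bm p)
    (fun t x h => by simp only [hDz t x h, map_zero, zero_div])
  obtain ⟨am, ham, hamper, hamz, hamsq, hamle, hamb⟩ := exists_amp hχ hχ0 hχ1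
    (e := fun p => -(Lp (D p) / km)) ((Lp.contDiff.comp hD).div_const _).neg
    (fun t x => by simp only [hDper]) hδ
    (fun p => by rw [abs_neg, abs_div, abs_of_pos hkm, div_le_iff₀ hkm, mul_comm]; exact S.bp p)
    (fun t x h => by simp only [hDz t x h, map_zero, zero_div, neg_zero])
  -- tolerance
  set τ := min (θ / 4) (min (√δ) (min (kp * δ / (32 * C)) (km * δ / (32 * C)))) with hτd
  have hτ : 0 < τ := by positivity
  have hτ1 : τ ≤ θ / 4 := min_le_left _ _
  have hτ2 : τ ≤ √δ := (min_le_right _ _).trans (min_le_left _ _)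
  have hτ3 : C * (2 * τ) ≤ kp * δ / 16 := by
    have : τ ≤ kp * δ / (32 * C) :=
      (min_le_right _ _).trans ((min_le_right _ _).trans (min_le_left _ _))
    rw [le_div_iff₀ (by positivity)] at this
    linarith
  have hτ4 : C * (2 * τ) ≤ km * δ / 16 := by
    have : τ ≤ km * δ / (32 * C) :=
      (min_le_right _ _).trans ((min_le_right _ _).trans (min_le_right _ _))
    rw [le_div_iff₀ (by positivity)] at this
    linarith
  have hout14 : ∀ t, t < 1 ∨ 4 < t → t < α' ∨ β' < t := fun t ht =>
    ht.imp (fun h => by linarith) (fun h => by linarith)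
  have hout' : ∀ t, t < α' ∨ β' < t → t < α ∨ β < t := fun t ht =>
    ht.imp (fun h => by linarith) (fun h => by linarith)
  obtain ⟨ψ₁, hψ₁, hq₁, hz₁, hc₁, hx₁, hD₁⟩ := Wp c ψ ap τ hτ hψ hquasi
    (fun p => (hsmall p).trans (by linarith))
    (fun t x ht => S.outx t x (hout' t (hout14 t ht))) hap happer
    (fun t x ht => hapz t x (hχout t (hout14 t ht)))
    (fun p => (hapb p).trans_lt (by linarith))
  have hsame₁ : ∀ t x, t < α' ∨ β' < t → ψ₁ (t, x) = ψ (t, x) := fun t x ht =>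
    hz₁ _ (hapz t x (hχout t ht))
  have hx₁' : ∀ p, ‖dxx ψ₁ p - dxx ψ p‖ ≤ 9 * √δ := fun p => by
    linarith [hx₁ p, hapb p]
  obtain ⟨ψ₂, hψ₂, hq₂, hz₂, hc₂, hx₂, hD₂⟩ := Wm c ψ₁ am τ hτ hψ₁ hq₁
    (fun p => by
      have := norm_add_le (dxx ψ₁ p - dxx ψ p) (dxx ψ p)
      rw [sub_add_cancel] at this
      linarith [hx₁' p, hsmall p])
    (fun t x ht => by
      rw [← S.outx t x (hout' t (hout14 t ht)), dxx, dxx, fderiv_out hsame₁ t x (hout14 t ht)])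
    ham hamper
    (fun t x ht => hamz t x (hχout t (hout14 t ht)))
    (fun p => (hamb p).trans_lt (by linarith))
  have hsame₂ : ∀ t x, t < α' ∨ β' < t → ψ₂ (t, x) = ψ (t, x) := fun t x ht =>
    (hz₂ _ (hamz t x (hχout t ht))).trans (hsame₁ t x ht)
  -- subtract the mean
  obtain ⟨G, hG, hG0, hGd⟩ := exists_antideriv (g := fun t => 2 * δ * χ t ^ 2)
    (contDiff_const.mul (hχ.pow 2))
  set z : X := kp • em - km • ep with hzd
  set ψ' : ℝ × ℝ → X := fun p => ψ₂ p - G p.1 • z with hψ'd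
  have hψ' : ContDiff ℝ ∞ ψ' := hψ₂.sub ((hG.comp contDiff_fst).smul contDiff_const)
  have hdt : ∀ t x, dtt ψ' (t, x) = dtt ψ₂ (t, x) - (2 * δ * χ t ^ 2) • z := by
    intro t x
    have e1 := hasDerivAt_dtt (smooth_diff hψ' (t, x))
    have e2 := (hasDerivAt_dtt (smooth_diff hψ₂ (t, x))).sub ((hGd t).smul_const z)
    exact e1.unique e2
  have hdx : ∀ p, dxx ψ' p = dxx ψ₂ p := by
    rintro ⟨t, x⟩
    have e1 := hasDerivAt_dxx (smooth_diff hψ' (t, x))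
    have e2 := (hasDerivAt_dxx (smooth_diff hψ₂ (t, x))).sub_const (G t • z)
    exact e1.unique e2
  have hdiff : ∀ p, ‖ψ₂ p - ψ p‖ ≤ θ / 2 := by
    intro p
    have := norm_add_le (ψ₂ p - ψ₁ p) (ψ₁ p - ψ p)
    rw [sub_add_sub_cancel] at this
    linarith [hc₁ p, hc₂ p]
  have hdecomp : ∀ p, ∃ q₁ q₂ : ℝ, ∃ e : X, 0 ≤ q₁ ∧ q₁ ≤ 1 ∧ 0 ≤ q₂ ∧ q₂ ≤ 1 ∧
      ‖e‖ ≤ 24 * σ * δ + 2 * τ ∧ dtt ψ' p + f (dxx ψ' p) =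
        D p - Lm (D p) • em - Lp (D p) • ep + (q₁ * (ap p ^ 2 / 2) * μp) • ep
          + (q₂ * (am p ^ 2 / 2) * μm) • em + e := by
    rintro ⟨t, x⟩
    obtain ⟨q₁, hq10, hq11, hE1⟩ := hD₁ (t, x)
    obtain ⟨q₂, hq20, hq21, hE2⟩ := hD₂ (t, x)
    refine ⟨q₁, q₂, _ + _, hq10, hq11, hq20, hq21, (norm_add_le _ _).trans
      ((add_le_add hE1 hE2).trans ?_), ?_⟩
    · have i1 := mul_le_mul_of_nonneg_left (haple (t, x)) hσ0.le
      have i2 := mul_le_mul_of_nonneg_left (hamle (t, x)) hσ0.le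
      linarith
    · rw [hdx, hdt]
      have a1 : ap (t, x) ^ 2 / 4 * kp = 2 * δ * χ t ^ 2 * kp - Lm (D (t, x)) := by
        rw [hapsq]; field_simp
      have a2 : am (t, x) ^ 2 / 4 * (-km) = -(2 * δ * χ t ^ 2 * km) - Lp (D (t, x)) := by
        rw [hamsq]; field_simp; ring
      rw [a1, a2]
      simp only [hzd]
      have hD' : D (t, x) = dtt ψ (t, x) + f (dxx ψ (t, x)) := rfl
      generalize hLm : Lm (D (t, x)) = y1
      generalize hLp : Lp (D (t, x)) = y2
      rw [hD']
      module
  refine ⟨ψ', ⟨hψ', ?_, ?_, ?_, ?_, ?_⟩, ?_, ?_⟩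
  · intro t x; simp only [hψ'd, hq₂]; abel
  · intro t x ht
    rw [hdx, ← S.outx t x (hout' t ht), dxx, dxx, fderiv_out hsame₂ t x ht]
  · intro t x ht
    rw [hdt, hχout t ht, ← S.outt t x (hout' t ht), dtt, dtt, fderiv_out hsame₂ t x ht]
    simp
  · intro p
    obtain ⟨q₁, q₂, e, h1, h2, h3, h4, he, heq⟩ := hdecomp p
    rw [heq]
    simp only [map_add, map_sub, map_smul, h11, h12, h21, h22, smul_eq_mul, mul_one, mul_zero,
      sub_self, sub_zero, zero_sub, add_zero, zero_add]
    have b1 : |q₂ * (am p ^ 2 / 2) * μm| ≤ 1 * (12 * δ / 2) * (1 / 100 * kp) := by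
      rw [abs_mul, abs_mul, abs_of_nonneg h3, abs_of_nonneg (a := am p ^ 2 / 2) (by positivity)]
      gcongr; exact hamle p
    have b2 := hCm e
    have b3 := mul_le_mul_of_nonneg_left he hC.le
    have b4 := mul_le_mul_of_nonneg_right hσ1 hδ.le
    have b5 := abs_add_le (q₂ * (am p ^ 2 / 2) * μm) (Lm e)
    have b6 := mul_pos hkp hδ
    linarith
  · intro p
    obtain ⟨q₁, q₂, e, h1, h2, h3, h4, he, heq⟩ := hdecomp p
    rw [heq]
    simp only [map_add, map_sub, map_smul, h11, h12, h21, h22, smul_eq_mul, mul_one, mul_zero,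
      sub_self, sub_zero, zero_sub, add_zero, zero_add]
    have b1 : |q₁ * (ap p ^ 2 / 2) * μp| ≤ 1 * (12 * δ / 2) * (1 / 100 * km) := by
      rw [abs_mul, abs_mul, abs_of_nonneg h1, abs_of_nonneg (a := ap p ^ 2 / 2) (by positivity)]
      gcongr; exact haple p
    have b2 := hCp e
    have b3 := mul_le_mul_of_nonneg_left he hC.le
    have b4 := mul_le_mul_of_nonneg_right hσ2 hδ.le
    have b5 := abs_add_le (q₁ * (ap p ^ 2 / 2) * μp) (Lp e)
    have b6 := mul_pos hkm hδ
    linarith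
  · intro p
    rw [hdx]
    have := norm_add_le (dxx ψ₂ p - dxx ψ₁ p) (dxx ψ₁ p - dxx ψ p)
    rw [sub_add_sub_cancel] at this
    linarith [hx₁' p, hx₂ p, hamb p]
  · intro t x
    have e : ψ' (t, x) - ψ' (t, 0) - (ψ (t, x) - ψ (t, 0)) =
        (ψ₂ (t, x) - ψ (t, x)) - (ψ₂ (t, 0) - ψ (t, 0)) := by
      simp only [hψ'd]; abel
    rw [e]
    have := norm_sub_le (ψ₂ (t, x) - ψ (t, x)) (ψ₂ (t, 0) - ψ (t, 0))
    linarith [hdiff (t, x), hdiff (t, 0)]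

end step

lemma dtt_dxx_comm {g : ℝ × ℝ → ℝ} (hg : ContDiff ℝ ∞ g) (p : ℝ × ℝ) :
    dtt (dxx g) p = dxx (dtt g) p := by
  have h2 : HasFDerivAt (fderiv ℝ g) (fderiv ℝ (fderiv ℝ g) p) p :=
    ((hg.fderiv_right (m := ∞) (by simp)).differentiable (by simp) p).hasFDerivAt
  have hs := second_derivative_symmetric (fun y => (smooth_diff hg y).hasFDerivAt) h2 (1, 0) (0, 1)
  have e1 : HasFDerivAt (dxx g) _ p := h2.clm_apply (hasFDerivAt_const ((0, 1) : ℝ × ℝ) p)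
  have e2 : HasFDerivAt (dtt g) _ p := h2.clm_apply (hasFDerivAt_const ((1, 0) : ℝ × ℝ) p)
  rw [dtt, dxx, e1.fderiv, e2.fderiv]
  simpa using hs

lemma weak_smooth {g φ : ℝ × ℝ → ℝ} (hg : ContDiff ℝ ∞ g) (hφ : ContDiff ℝ 1 φ) {c : ℝ}
    (hq : ∀ t x, g (t, x + 1) = g (t, x) + c) (hper : ∀ t x, φ (t, x + 1) = φ (t, x)) {T : ℝ}
    (hT : ∀ x, φ (T, x) = 0) :
    (∫ t in (0 : ℝ)..T, ∫ x in (0 : ℝ)..1, (dxx g (t, x) * dtt φ (t, x) - dtt g (t, x) * dxx φ (t, x)))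
      + ∫ x in (0 : ℝ)..1, dxx g (0, x) * φ (0, x) = 0 := by
  have dφ : ∀ p, HasFDerivAt φ (fderiv ℝ φ p) p := fun p =>
    (hφ.differentiable (by simp) p).hasFDerivAt
  have dgx : ∀ p, HasFDerivAt (dxx g) (fderiv ℝ (dxx g) p) p := fun p =>
    (smooth_diff hg.dxx p).hasFDerivAt
  have dgt : ∀ p, HasFDerivAt (dtt g) (fderiv ℝ (dtt g) p) p := fun p =>
    (smooth_diff hg.dtt p).hasFDerivAt
  have hc : Continuous (fun p => fderiv ℝ φ p) := hφ.continuous_fderiv (by simp)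
  have key : ∀ p, (dxx g p • fderiv ℝ φ p + φ p • fderiv ℝ (dxx g) p) ((1, 0) : ℝ × ℝ) +
      (-(dtt g p • fderiv ℝ φ p + φ p • fderiv ℝ (dtt g) p)) ((0, 1) : ℝ × ℝ) =
      dxx g p * dtt φ p - dtt g p * dxx φ p := by
    intro p
    have h := dtt_dxx_comm hg p
    have h' : fderiv ℝ (dxx g) p (1, 0) = fderiv ℝ (dtt g) p (0, 1) := h
    simp only [add_apply, smul_apply, neg_apply, smul_eq_mul, h']
    simp only [dtt, dxx]
    ring
  have hcont : Continuous (fun p => dxx g p * dtt φ p - dtt g p * dxx φ p) :=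
    (hg.dxx.continuous.mul (hc.clm_apply continuous_const)).sub
      (hg.dtt.continuous.mul (hc.clm_apply continuous_const))
  have := integral2_divergence_prod_of_hasFDerivAt (fun p => dxx g p * φ p)
    (fun p => -(dtt g p * φ p)) (fun p => dxx g p • fderiv ℝ φ p + φ p • fderiv ℝ (dxx g) p)
    (fun p => -(dtt g p • fderiv ℝ φ p + φ p • fderiv ℝ (dtt g) p)) 0 0 T 1
    (hg.dxx.continuous.mul hφ.continuous).continuousOn
    (hg.dtt.continuous.mul hφ.continuous).neg.continuousOn
    (fun p _ => (dgx p).mul (dφ p)) (fun p _ => ((dgt p).mul (dφ p)).neg)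
    (by
      simp only [key]
      exact hcont.continuousOn.integrableOn_compact (isCompact_uIcc.prod isCompact_uIcc))
  simp only [key] at this
  rw [this]
  have e1 : ∀ t, dtt g (t, 1) = dtt g (t, 0) := fun t => by
    have := dtt_quasi hq t 0; rwa [zero_add] at this
  have e2 : ∀ t, φ (t, 1) = φ (t, 0) := fun t => by
    have := hper t 0; rwa [zero_add] at this
  simp [e1, e2, hT]

lemma abs_coord_le (w : E2) (i : Fin 2) : |w i| ≤ ‖w‖ := by
  simpa using PiLp.norm_apply_le w i

lemma contDiff_coord {ψ : ℝ × ℝ → E2} (h : ContDiff ℝ ∞ ψ) (i : Fin 2) :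
    ContDiff ℝ ∞ (fun p => ψ p i) :=
  (EuclideanSpace.proj (𝕜 := ℝ) i).contDiff.comp h

lemma fderiv_coord {ψ : ℝ × ℝ → E2} (h : ContDiff ℝ ∞ ψ) (i : Fin 2) (p v : ℝ × ℝ) :
    fderiv ℝ (fun p => ψ p i) p v = (fderiv ℝ ψ p v) i := by
  have h1 := (EuclideanSpace.proj (𝕜 := ℝ) (ι := Fin 2) i : E2 →L[ℝ] ℝ).hasFDerivAt.comp p (smooth_diff h p).hasFDerivAt
  have h2 : HasFDerivAt (fun p => ψ p i) _ p := h1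
  rw [h2.fderiv]; rfl

lemma weak_limit {f : E2 → E2} {B : Set E2} {u : ℝ × ℝ → E2} (hu : Continuous u)
    (hfu : Continuous (fun p => f (u p))) (hper : ∀ t x, u (t, x + 1) = u (t, x))
    (hB : ∀ p, u p ∈ B) {c : E2}
    (happ : ∀ ε > 0, ∃ ψ : ℝ × ℝ → E2, ContDiff ℝ ∞ ψ ∧ (∀ t x, ψ (t, x + 1) = ψ (t, x) + c) ∧
      (∀ p, ‖u p - dxx ψ p‖ ≤ ε) ∧ ∀ p, ‖f (u p) + dtt ψ p‖ ≤ ε) :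
    IsContWeakSol f B u := by
  refine ⟨hu.continuousOn, hper, fun t x _ => hB _, ?_⟩
  rintro φ hφ hφper ⟨T₀, hT₀⟩ i
  set T := max T₀ 1 with hTd
  have hT1 : 0 < T := lt_of_lt_of_le one_pos (le_max_right _ _)
  have hT : ∀ t x, T ≤ |t| → φ (t, x) = 0 := fun t x h => hT₀ t x ((le_max_left _ _).trans h)
  have hc : Continuous (fun p => fderiv ℝ φ p) := hφ.continuous_fderiv (by simp)
  have hcu : Continuous (fun p => u p i) := (EuclideanSpace.proj (𝕜 := ℝ) i).continuous.comp hu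
  have hcf : Continuous (fun p => f (u p) i) :=
    (EuclideanSpace.proj (𝕜 := ℝ) i).continuous.comp hfu
  set h : ℝ × ℝ → ℝ := fun p => u p i * dtt φ p + f (u p) i * dxx φ p with hhd
  have hct : Continuous (dtt φ) := hc.clm_apply continuous_const
  have hcx : Continuous (dxx φ) := hc.clm_apply continuous_const
  have hh : Continuous h := (hcu.mul hct).add (hcf.mul hcx)
  -- reduce to interval integrals
  have hred : (∫ t in Set.Ioi (0 : ℝ), ∫ x in Set.Ioc (0 : ℝ) 1,
      (u (t, x) i * fderiv ℝ φ (t, x) (1, 0) + f (u (t, x)) i * fderiv ℝ φ (t, x) (0, 1))) =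
      ∫ t in (0 : ℝ)..T, ∫ x in (0 : ℝ)..1, h (t, x) := by
    rw [intervalIntegral.integral_of_le hT1.le]
    simp only [intervalIntegral.integral_of_le zero_le_one]
    refine setIntegral_eq_of_subset_of_forall_sdiff_eq_zero measurableSet_Ioi
      (fun t ht => ht.1) ?_
    rintro t ⟨ht, ht'⟩
    have hTt : T < t := by
      by_contra hh; exact ht' ⟨ht, not_lt.1 hh⟩
    have hz : ∀ x, fderiv ℝ φ (t, x) = 0 := by
      intro x
      rw [fderiv_out (g' := fun _ => 0) (a := -T) (b := T) (fun s y hs => hT s y ?_) t x (Or.inr hTt)]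
      · simp
      · rcases hs with hs | hs
        · exact le_abs.2 (Or.inr (by linarith))
        · exact le_abs.2 (Or.inl hs.le)
    simp [hz]
  rw [hred, ← intervalIntegral.integral_of_le zero_le_one]
  -- bound on test function
  obtain ⟨K1, hK1⟩ := ((isCompact_Icc (a := (0:ℝ)) (b := T)).prod
    (isCompact_Icc (a := (0:ℝ)) (b := 1))).exists_bound_of_continuousOn hct.continuousOn
  obtain ⟨K2, hK2⟩ := ((isCompact_Icc (a := (0:ℝ)) (b := T)).prod
    (isCompact_Icc (a := (0:ℝ)) (b := 1))).exists_bound_of_continuousOn hcx.continuousOn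
  obtain ⟨K3, hK3⟩ := ((isCompact_Icc (a := (0:ℝ)) (b := T)).prod
    (isCompact_Icc (a := (0:ℝ)) (b := 1))).exists_bound_of_continuousOn hφ.continuous.continuousOn
  have hmem : ((0 : ℝ), (0 : ℝ)) ∈ Set.Icc (0 : ℝ) T ×ˢ Set.Icc (0 : ℝ) 1 :=
    ⟨⟨le_rfl, hT1.le⟩, ⟨le_rfl, zero_le_one⟩⟩
  have hK10 : 0 ≤ K1 := (norm_nonneg _).trans (hK1 _ hmem)
  have hK20 : 0 ≤ K2 := (norm_nonneg _).trans (hK2 _ hmem)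
  have hK30 : 0 ≤ K3 := (norm_nonneg _).trans (hK3 _ hmem)
  set I := (∫ t in (0 : ℝ)..T, ∫ x in (0 : ℝ)..1, h (t, x)) + ∫ x in (0 : ℝ)..1, u (0, x) i * φ (0, x)
    with hI
  have hbound : ∀ ε > 0, |I| ≤ ε * ((K1 + K2) * T + K3) := by
    intro ε hε
    obtain ⟨ψ, hψ, hq, hux, hut⟩ := happ ε hε
    have w := weak_smooth (contDiff_coord hψ i) hφ (c := c i) (fun t x => by simp [hq]) hφper
      (T := T) (fun x => hT T x (le_abs_self _))
    have ex : ∀ p, dxx (fun p => ψ p i) p = dxx ψ p i := fun p => fderiv_coord hψ i p _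
    have et : ∀ p, dtt (fun p => ψ p i) p = dtt ψ p i := fun p => fderiv_coord hψ i p _
    simp only [ex, et] at w
    have cx : Continuous (fun p => dxx ψ p i) :=
      (EuclideanSpace.proj (𝕜 := ℝ) i).continuous.comp hψ.dxx.continuous
    have ct : Continuous (fun p => dtt ψ p i) :=
      (EuclideanSpace.proj (𝕜 := ℝ) i).continuous.comp hψ.dtt.continuous
    set h' : ℝ × ℝ → ℝ := fun p => dxx ψ p i * dtt φ p - dtt ψ p i * dxx φ p with hh'd
    have hh' : Continuous h' := (cx.mul hct).sub (ct.mul hcx)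
    have hxc : ∀ (k : ℝ × ℝ → ℝ), Continuous k → ∀ t, Continuous (fun x => k (t, x)) :=
      fun k hk t => hk.comp (continuous_const.prodMk continuous_id)
    have htc : ∀ (k : ℝ × ℝ → ℝ), Continuous k → Continuous (fun t => ∫ x in (0 : ℝ)..1, k (t, x)) :=
      fun k hk => intervalIntegral.continuous_parametric_intervalIntegral_of_continuous'
        (f := fun t x => k (t, x)) hk 0 1
    have w' : (∫ t in (0 : ℝ)..T, ∫ x in (0 : ℝ)..1, h' (t, x))
      + ∫ x in (0 : ℝ)..1, dxx ψ (0, x) i * φ (0, x) = 0 := w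
    have e : I = (∫ t in (0 : ℝ)..T, ∫ x in (0 : ℝ)..1, (h (t, x) - h' (t, x))) +
        ∫ x in (0 : ℝ)..1, (u (0, x) i * φ (0, x) - dxx ψ (0, x) i * φ (0, x)) := by
      have a1 : ∀ t, (∫ x in (0 : ℝ)..1, (h (t, x) - h' (t, x))) =
          (∫ x in (0 : ℝ)..1, h (t, x)) - ∫ x in (0 : ℝ)..1, h' (t, x) := fun t =>
        intervalIntegral.integral_sub ((hxc h hh t).intervalIntegrable _ _)
          ((hxc h' hh' t).intervalIntegrable _ _)
      simp only [a1]
      rw [intervalIntegral.integral_sub ((htc h hh).intervalIntegrable _ _)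
          ((htc h' hh').intervalIntegrable _ _),
        intervalIntegral.integral_sub
          ((hxc (fun p => u p i * φ p) (hcu.mul hφ.continuous) 0).intervalIntegrable _ _)
          ((hxc (fun p => dxx ψ p i * φ p) (cx.mul hφ.continuous) 0).intervalIntegrable _ _)]
      rw [hI]; linarith
    have d1 : ∀ p, |u p i - dxx ψ p i| ≤ ε := fun p => by
      have := (abs_coord_le (u p - dxx ψ p) i).trans (hux p); simpa using this
    have d2 : ∀ p, |f (u p) i + dtt ψ p i| ≤ ε := fun p => by
      have := (abs_coord_le (f (u p) + dtt ψ p) i).trans (hut p); simpa using this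
    have b1 : |∫ t in (0 : ℝ)..T, ∫ x in (0 : ℝ)..1, (h (t, x) - h' (t, x))| ≤ ε * (K1 + K2) * |T - 0| := by
      rw [← Real.norm_eq_abs]
      apply intervalIntegral.norm_integral_le_of_norm_le_const
      intro t ht
      rw [Set.uIoc_of_le hT1.le] at ht
      have : ‖∫ x in (0 : ℝ)..1, (h (t, x) - h' (t, x))‖ ≤ ε * (K1 + K2) * |1 - 0| := by
        apply intervalIntegral.norm_integral_le_of_norm_le_const
        intro x hx
        rw [Set.uIoc_of_le zero_le_one] at hx
        have hm : (t, x) ∈ Set.Icc (0 : ℝ) T ×ˢ Set.Icc (0 : ℝ) 1 :=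
          ⟨⟨ht.1.le, ht.2⟩, ⟨hx.1.le, hx.2⟩⟩
        have e2 : h (t, x) - h' (t, x) = (u (t, x) i - dxx ψ (t, x) i) * dtt φ (t, x) +
            (f (u (t, x)) i + dtt ψ (t, x) i) * dxx φ (t, x) := by
          simp only [hhd, hh'd]; ring
        rw [e2, Real.norm_eq_abs]
        refine (abs_add_le _ _).trans ?_
        rw [abs_mul, abs_mul, mul_add]
        exact add_le_add (mul_le_mul (d1 _) (hK1 _ hm) (abs_nonneg _) hε.le)
          (mul_le_mul (d2 _) (hK2 _ hm) (abs_nonneg _) hε.le)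
      simpa using this
    have b2 : |∫ x in (0 : ℝ)..1, (u (0, x) i * φ (0, x) - dxx ψ (0, x) i * φ (0, x))| ≤
        ε * K3 * |1 - 0| := by
      rw [← Real.norm_eq_abs]
      apply intervalIntegral.norm_integral_le_of_norm_le_const
      intro x hx
      rw [Set.uIoc_of_le zero_le_one] at hx
      have hm : ((0 : ℝ), x) ∈ Set.Icc (0 : ℝ) T ×ˢ Set.Icc (0 : ℝ) 1 :=
          ⟨⟨le_rfl, hT1.le⟩, ⟨hx.1.le, hx.2⟩⟩
      rw [← sub_mul, Real.norm_eq_abs, abs_mul]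
      exact mul_le_mul (d1 _) (hK3 _ hm) (abs_nonneg _) hε.le
    rw [sub_zero, abs_of_pos hT1] at b1
    rw [sub_zero, abs_one, mul_one] at b2
    rw [e]
    refine (abs_add_le _ _).trans ?_
    linarith
  -- conclude
  by_contra hne
  have hpos : 0 < |I| := abs_pos.2 hne
  set M := (K1 + K2) * T + K3 with hM
  have hM0 : 0 ≤ M := by positivity
  have := hbound (|I| / (2 * (M + 1))) (by positivity)
  rw [div_mul_eq_mul_div, le_div_iff₀ (by positivity)] at this
  nlinarith

lemma dep_seq {α : Type*} (P : ℕ → α → Prop) (R : ℕ → α → α → Prop) {a0 : α} (h0 : P 0 a0)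
    (hs : ∀ n a, P n a → ∃ b, P (n + 1) b ∧ R n a b) :
    ∃ s : ℕ → α, s 0 = a0 ∧ ∀ n, P n (s n) ∧ R n (s n) (s (n + 1)) := by
  choose! F hF using hs
  set s : ℕ → α := fun n => Nat.rec a0 (fun n a => F n a) n with hsd
  have hsucc : ∀ n, s (n + 1) = F n (s n) := fun n => rfl
  have hP : ∀ n, P n (s n) := by
    intro n
    induction n with
    | zero => exact h0
    | succ n ih => rw [hsucc]; exact (hF n _ ih).1
  exact ⟨s, rfl, fun n => ⟨hP n, by rw [hsucc]; exact (hF n _ (hP n)).2⟩⟩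

/-- affine plus scalar perturbation -/
lemma base_deriv {X : Type*} [NormedAddCommGroup X] [NormedSpace ℝ X] (c d e : X) {P : ℝ × ℝ → ℝ}
    (hP : ContDiff ℝ ∞ P) :
    ContDiff ℝ ∞ (fun p : ℝ × ℝ => p.2 • c - p.1 • d + P p • e) ∧
    (∀ p, dxx (fun p : ℝ × ℝ => p.2 • c - p.1 • d + P p • e) p = c + dxx P p • e) ∧
    (∀ p, dtt (fun p : ℝ × ℝ => p.2 • c - p.1 • d + P p • e) p = -d + dtt P p • e) := by
  have hs : ContDiff ℝ ∞ (fun p : ℝ × ℝ => p.2 • c - p.1 • d + P p • e) :=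
    ((contDiff_snd.smul contDiff_const).sub (contDiff_fst.smul contDiff_const)).add
      (hP.smul contDiff_const)
  refine ⟨hs, ?_, ?_⟩
  · rintro ⟨t, x⟩
    have e1 := hasDerivAt_dxx (smooth_diff hs (t, x))
    have e2 := (((hasDerivAt_id x).smul_const c).sub_const (t • d)).add
      ((hasDerivAt_dxx (smooth_diff hP (t, x))).smul_const e)
    rw [one_smul] at e2
    exact e1.unique e2
  · rintro ⟨t, x⟩
    have e1 := hasDerivAt_dtt (smooth_diff hs (t, x))
    have e2 := (((hasDerivAt_id t).smul_const d).const_sub (x • c)).add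
      ((hasDerivAt_dtt (smooth_diff hP (t, x))).smul_const e)
    rw [one_smul] at e2
    exact e1.unique e2

lemma init_state {X : Type*} [NormedAddCommGroup X] [NormedSpace ℝ X] {f : X → X} {c e : X}
    (hfc : ContinuousAt f c) (he : ‖e‖ = 1) {Lm Lp : X →L[ℝ] ℝ} {km kp C δ ρ : ℝ} (hkm : 0 < km)
    (hkp : 0 < kp) (hC : 0 < C) (hCm : ∀ w, |Lm w| ≤ C * ‖w‖) (hCp : ∀ w, |Lp w| ≤ C * ‖w‖)
    (hδ : 0 < δ) (hρ : 0 < ρ) :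
    ∃ ψ, IsState f Lm Lp km kp δ 2 3 c ψ ∧ (∀ p, ‖dxx ψ p - c‖ ≤ ρ) ∧
      ψ (5 / 2, 1 / 4) - ψ (5 / 2, 0) - (1 / 4 : ℝ) • c ≠ 0 := by
  obtain ⟨b, hb, hb0, hb1, hbone, hbout⟩ := exists_cutoff (α := 9 / 4) (β := 11 / 4) (α' := 2)
    (β' := 3) (by norm_num) (by norm_num)
  set P : ℝ × ℝ → ℝ := fun p => b p.1 * Real.sin (2 * Real.pi * p.2) with hPd
  have hP : ContDiff ℝ ∞ P := (hb.comp contDiff_fst).mul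
    (Real.contDiff_sin.comp (contDiff_const.mul contDiff_snd))
  have hPper : ∀ t x, P (t, x + 1) = P (t, x) := by
    intro t x
    simp only [hPd, mul_add, mul_one, Real.sin_add_two_pi]
  have hPout : ∀ t x, t < 2 ∨ 3 < t → P (t, x) = 0 := fun t x ht => by simp [hPd, hbout t ht]
  obtain ⟨M, hM, hM0, hMt, hMx⟩ := bdd_smooth hP hPper (fun t x ht => hPout t x
    (ht.imp (fun h => by linarith) (fun h => by linarith)))
  set ϖ := min (kp * δ / (2 * C)) (km * δ / (2 * C)) with hϖd
  have hϖ : 0 < ϖ := by positivity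
  have hϖ1 : C * (2 * ϖ) ≤ kp * δ := by
    have : ϖ ≤ kp * δ / (2 * C) := min_le_left _ _
    rw [le_div_iff₀ (by positivity)] at this; linarith
  have hϖ2 : C * (2 * ϖ) ≤ km * δ := by
    have : ϖ ≤ km * δ / (2 * C) := min_le_right _ _
    rw [le_div_iff₀ (by positivity)] at this; linarith
  obtain ⟨r, hr, hfr⟩ := Metric.continuousAt_iff.1 hfc ϖ hϖ
  set m := min (r / 2) (min ρ ϖ) with hmd
  have hm : 0 < m := by positivity
  set s := m / (M + 1) with hsd
  have hs : 0 < s := by positivity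
  have hsM : s * M ≤ m := by
    rw [hsd, div_mul_eq_mul_div, div_le_iff₀ (by positivity)]; nlinarith
  have hsP : ContDiff ℝ ∞ (fun p => s * P p) := contDiff_const.mul hP
  have hfd : ∀ p v, fderiv ℝ (fun p => s * P p) p v = s * fderiv ℝ P p v := by
    intro p v
    have : HasFDerivAt (fun p => s * P p) _ p := (smooth_diff hP p).hasFDerivAt.const_mul s
    rw [this.fderiv]; rfl
  obtain ⟨h1, h2, h3⟩ := base_deriv c (f c) e hsP
  set ψ : ℝ × ℝ → X := fun p : ℝ × ℝ => p.2 • c - p.1 • f c + (s * P p) • e with hψd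
  have hz : ∀ t x, t < 2 ∨ 3 < t → fderiv ℝ P (t, x) = 0 := by
    intro t x ht
    rw [fderiv_out (g' := fun _ => 0) hPout t x ht]; simp
  have hx : ∀ p, ‖dxx ψ p - c‖ ≤ m := by
    intro p
    rw [h2, add_sub_cancel_left, norm_smul, he, mul_one, dxx, hfd, norm_mul, Real.norm_eq_abs,
      abs_of_pos hs]
    exact (mul_le_mul_of_nonneg_left (hMx p) hs.le).trans hsM
  have ht : ∀ p, ‖dtt ψ p + f c‖ ≤ m := by
    intro p
    rw [h3, neg_add_cancel_comm, norm_smul, he, mul_one, dtt, hfd, norm_mul, Real.norm_eq_abs,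
      abs_of_pos hs]
    exact (mul_le_mul_of_nonneg_left (hMt p) hs.le).trans hsM
  have hD : ∀ p, ‖dtt ψ p + f (dxx ψ p)‖ ≤ 2 * ϖ := by
    intro p
    have i1 : dist (f (dxx ψ p)) (f c) < ϖ := hfr (by
      rw [dist_eq_norm]
      exact (hx p).trans_lt ((min_le_left _ _).trans_lt (by linarith)))
    rw [dist_eq_norm] at i1
    have i2 := norm_add_le (dtt ψ p + f c) (f (dxx ψ p) - f c)
    rw [add_add_sub_cancel] at i2
    have i3 : m ≤ ϖ := (min_le_right _ _).trans (min_le_right _ _)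
    linarith [ht p]
  refine ⟨ψ, ⟨h1, ?_, ?_, ?_, ?_, ?_⟩, ?_, ?_⟩
  · intro t x
    simp only [hψd, hPper]; module
  · intro t x h
    rw [h2, dxx, hfd, hz t x h]; simp
  · intro t x h
    rw [h3, dtt, hfd, hz t x h]; simp
  · intro p
    exact (hCm _).trans ((mul_le_mul_of_nonneg_left (hD p) hC.le).trans hϖ1)
  · intro p
    exact (hCp _).trans ((mul_le_mul_of_nonneg_left (hD p) hC.le).trans hϖ2)
  · intro p
    exact (hx p).trans ((min_le_right _ _).trans (min_le_left _ _))
  · have hb5 : b (5 / 2) = 1 := hbone _ (by norm_num) (by norm_num)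
    have e1 : P (5 / 2, 1 / 4) = 1 := by
      simp only [hPd, hb5, one_mul]
      rw [show 2 * Real.pi * (1 / 4) = Real.pi / 2 by ring, Real.sin_pi_div_two]
    have e2 : P (5 / 2, 0) = 0 := by simp [hPd]
    have e3 : ψ (5 / 2, 1 / 4) - ψ (5 / 2, 0) - (1 / 4 : ℝ) • c = s • e := by
      simp only [hψd, e1, e2]; module
    rw [e3]
    refine smul_ne_zero hs.ne' ?_
    rw [← norm_ne_zero_iff, he]; exact one_ne_zero

lemma const_sol {f : E2 → E2} {B : Set E2} {c : E2} (hc : c ∈ B) :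
    IsContWeakSol f B (fun _ => c) := by
  obtain ⟨h1, h2, h3⟩ := base_deriv c (f c) 0 (P := fun _ => 0) contDiff_const
  refine weak_limit continuous_const continuous_const (fun _ _ => rfl) (fun _ => hc) (c := c) ?_
  intro ε hε
  refine ⟨_, h1, ?_, ?_, ?_⟩
  · intro t x; module
  · intro p; rw [h2]; simpa using hε.le
  · intro p; rw [h3]; simpa using hε.le

set_option maxHeartbeats 1000000 in
lemma core {V : Set E2} {f : E2 → E2} (hf : ContDiffOn ℝ ∞ f V) {η : ℝ} (hη : 0 < η)
    (hball : Metric.ball 0 η ⊆ V) {em ep : E2} {Lm Lp : E2 →L[ℝ] ℝ}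
    (h11 : Lm em = 1) (h12 : Lm ep = 0) (h21 : Lp em = 0) (h22 : Lp ep = 1)
    (hem : ‖em‖ = 1) (hnorm : ∀ w, ‖w‖ ≤ |Lm w| + |Lp w|)
    {km kp μm μp σ C : ℝ} (hkm : 0 < km) (hkp : 0 < kp)
    (hμp : |μp| ≤ 1 / 100 * km) (hμm : |μm| ≤ 1 / 100 * kp) (hσ0 : 0 < σ) (hC : 0 < C)
    (hCm : ∀ w, |Lm w| ≤ C * ‖w‖) (hCp : ∀ w, |Lp w| ≤ C * ‖w‖)
    (hσ1 : 24 * σ * C ≤ kp / 16) (hσ2 : 24 * σ * C ≤ km / 16)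
    (Wp : WaveProp f em ep kp μp σ η) (Wm : WaveProp f ep em (-km) μm σ η)
    {c : E2} {ρ : ℝ} (hρ : 0 < ρ) (hcρ : Metric.ball c ρ ⊆ Metric.ball 0 (η / 2)) :
    ∃ u : ℝ × ℝ → E2, IsContWeakSol f (Metric.ball c ρ) u ∧ (∀ x, u (0, x) = c) ∧
      ∃ t x : ℝ, 0 ≤ t ∧ c ≠ u (t, x) := by
  have hballV : Metric.ball c ρ ⊆ V := hcρ.trans ((Metric.ball_subset_ball (by linarith)).trans hball)
  have hcV : c ∈ V := hballV (Metric.mem_ball_self hρ)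
  have hfρ : ContinuousOn f (Metric.ball c ρ) := hf.continuousOn.mono hballV
  have hfc : ContinuousAt f c := hfρ.continuousAt (Metric.ball_mem_nhds c hρ)
  set κ := min ρ η / 160 with hκd
  have hκ : 0 < κ := by positivity
  have hκ1 : 40 * κ ≤ ρ / 4 := by have := min_le_left ρ η; rw [hκd]; linarith
  have hκ2 : 20 * κ < η := by have := min_le_right ρ η; rw [hκd]; linarith
  obtain ⟨ψ0, hS0, hx0, hne0⟩ := init_state hfc hem hkm hkp hC hCm hCp
    (δ := (κ / 2 ^ 0) ^ 2) (ρ := ρ / 4) (by positivity) (by positivity)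
  set g := ‖ψ0 (5 / 2, 1 / 4) - ψ0 (5 / 2, 0) - (1 / 4 : ℝ) • c‖ with hgd
  have hg : 0 < g := norm_pos_iff.2 hne0
  have hpow : ∀ q : ℕ, (1 : ℝ) ≤ 2 ^ q := fun q => one_le_pow₀ (by norm_num)
  have hinv : ∀ q : ℕ, (0 : ℝ) < 1 / 2 ^ q ∧ (1 : ℝ) / 2 ^ q ≤ 1 := fun q =>
    ⟨by positivity, by rw [div_le_one (by positivity)]; exact hpow q⟩
  have hhalf : ∀ q : ℕ, (1 : ℝ) / 2 ^ (q + 1) = 1 / 2 ^ q / 2 := fun q => by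
    rw [pow_succ]; field_simp
  obtain ⟨ψ, hψ0, hψ⟩ := dep_seq
    (fun (q : ℕ) (ψ : ℝ × ℝ → E2) =>
      IsState f Lm Lp km kp ((κ / 2 ^ q) ^ 2) (1 + 1 / 2 ^ q) (4 - 1 / 2 ^ q) c ψ ∧
      ∀ p, ‖dxx ψ p - c‖ ≤ ρ / 4 + 40 * κ * (1 - 1 / 2 ^ q))
    (fun (q : ℕ) (ψ ψ' : ℝ × ℝ → E2) => (∀ p, ‖dxx ψ' p - dxx ψ p‖ ≤ 20 * (κ * (1 / 2 ^ q))) ∧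
      ∀ t x, ‖(ψ' (t, x) - ψ' (t, 0)) - (ψ (t, x) - ψ (t, 0))‖ ≤ g / 4 * (1 / 2 ^ q))
    (a0 := ψ0)
    (by
      refine ⟨?_, ?_⟩
      · have e1 : (1 : ℝ) + 1 / 2 ^ 0 = 2 := by norm_num
        have e2 : (4 : ℝ) - 1 / 2 ^ 0 = 3 := by norm_num
        rw [e1, e2]; exact hS0
      · intro p; simpa using hx0 p)
    (by
      rintro q ψ ⟨hS, hx⟩
      have hq := hinv q
      have hq' := hhalf q
      have hsq : √((κ / 2 ^ q) ^ 2) = κ * (1 / 2 ^ q) := by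
        rw [Real.sqrt_sq (by positivity)]; ring
      have hκq : κ * (1 / 2 ^ q) ≤ κ := mul_le_of_le_one_right hκ.le hq.2
      have hκq0 : 0 < κ * (1 / 2 ^ q) := mul_pos hκ hq.1
      obtain ⟨ψ', hS', hx', hw'⟩ := state_step hf hη hball h11 h12 h21 h22 hkm hkp hμp hμm hσ0 hC
        hCm hCp hσ1 hσ2 Wp Wm (δ := (κ / 2 ^ q) ^ 2) (α' := 1 + 1 / 2 ^ (q + 1))
        (β' := 4 - 1 / 2 ^ (q + 1)) (θ := g / 4 * (1 / 2 ^ q)) (by positivity)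
        (by rw [hsq]; linarith) (by linarith) (by linarith) (by linarith) (by linarith) hS
        (by
          intro p
          have : dxx ψ p ∈ Metric.ball (0 : E2) (η / 2) := hcρ (by
            rw [mem_ball_iff_norm]
            have := hx p
            nlinarith)
          simpa using this)
        (by positivity)
      rw [hsq] at hx'
      refine ⟨ψ', ⟨?_, ?_⟩, hx', hw'⟩
      · have : (κ / 2 ^ q) ^ 2 / 4 = (κ / 2 ^ (q + 1)) ^ 2 := by rw [pow_succ (2 : ℝ) q]; field_simp; norm_num
        rw [← this]; exact hS'
      · intro p
        have i1 := norm_add_le (dxx ψ' p - dxx ψ p) (dxx ψ p - c)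
        rw [sub_add_sub_cancel] at i1
        rw [hq']
        have := hx' p
        have := hx p
        linarith)
  -- the limit
  have hgeo : ∀ p q, dist (dxx (ψ q) p) (dxx (ψ (q + 1)) p) ≤ 40 * κ / 2 / 2 ^ q := by
    intro p q
    rw [dist_comm, dist_eq_norm]
    refine ((hψ q).2.1 p).trans (le_of_eq ?_)
    ring
  have hlim : ∀ p, ∃ v, Filter.Tendsto (fun q => dxx (ψ q) p) Filter.atTop (nhds v) := fun p =>
    cauchySeq_tendsto_of_complete (cauchySeq_of_le_geometric_two (hgeo p))
  choose u hu using hlim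
  have hclose : ∀ q p, ‖u p - dxx (ψ q) p‖ ≤ 40 * κ / 2 ^ q := by
    intro q p
    rw [← dist_eq_norm, dist_comm]
    exact dist_le_of_le_geometric_two_of_tendsto (hgeo p) (hu p) q
  have htend : Filter.Tendsto (fun q : ℕ => 40 * κ / 2 ^ q) Filter.atTop (nhds 0) := by
    have := (tendsto_pow_atTop_nhds_zero_of_lt_one (r := (1 / 2 : ℝ)) (by norm_num)
      (by norm_num)).const_mul (40 * κ)
    rw [mul_zero] at this
    refine this.congr (fun q => ?_)
    rw [one_div, inv_pow]; rfl
  have hcu : Continuous u := by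
    refine TendstoUniformly.continuous (F := fun q => dxx (ψ q)) (p := Filter.atTop) ?_
      (Filter.Frequently.of_forall fun q => (hψ q).1.1.smooth.dxx.continuous)
    rw [Metric.tendstoUniformly_iff]
    intro ε hε
    filter_upwards [htend.eventually_lt_const hε] with q hq p
    rw [dist_eq_norm]
    exact (hclose q p).trans_lt hq
  have hqb : ∀ q p, dxx (ψ q) p ∈ Metric.closedBall c (ρ / 2) := by
    intro q p
    rw [mem_closedBall_iff_norm]
    have := (hψ q).1.2 p
    have := hinv q
    nlinarith
  have hub : ∀ p, u p ∈ Metric.closedBall c (ρ / 2) := fun p =>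
    Metric.isClosed_closedBall.mem_of_tendsto (hu p) (Filter.Eventually.of_forall fun q => hqb q p)
  have hsub : Metric.closedBall c (ρ / 2) ⊆ Metric.ball c ρ :=
    Metric.closedBall_subset_ball (by linarith)
  have hfu : Continuous (fun p => f (u p)) :=
    hfρ.comp_continuous hcu (fun p => hsub (hub p))
  have huc : UniformContinuousOn f (Metric.closedBall c (ρ / 2)) :=
    (isCompact_closedBall c (ρ / 2)).uniformContinuousOn_of_continuous (hfρ.mono hsub)
  rw [Metric.uniformContinuousOn_iff] at huc
  refine ⟨u, weak_limit hcu hfu ?_ (fun p => hsub (hub p)) (c := c) ?_, ?_, ?_⟩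
  · intro t x
    refine tendsto_nhds_unique (hu (t, x + 1)) ((hu (t, x)).congr fun q => ?_)
    exact (dxx_quasi (hψ q).1.1.quasi t x).symm
  · intro ε hε
    obtain ⟨d, hd, hfd⟩ := huc (ε / 2) (by positivity)
    have ht2 : Filter.Tendsto (fun q : ℕ => (kp + km) * (κ / 2 ^ q) ^ 2) Filter.atTop (nhds 0) := by
      have := ((htend.div_const 40).pow 2).const_mul (kp + km)
      simp only [zero_div, ne_eq, OfNat.ofNat_ne_zero, not_false_eq_true, zero_pow, mul_zero] at this
      refine this.congr (fun q => ?_)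
      congr 2; ring
    obtain ⟨q, hq1, hq2, hq3⟩ := ((htend.eventually_lt_const hε).and
      ((htend.eventually_lt_const hd).and (ht2.eventually_lt_const (half_pos hε)))).exists
    refine ⟨ψ q, (hψ q).1.1.smooth, (hψ q).1.1.quasi, fun p => (hclose q p).trans hq1.le, ?_⟩
    intro p
    have i1 : dist (f (u p)) (f (dxx (ψ q) p)) < ε / 2 := hfd _ (hub p) _ (hqb q p) (by
      rw [dist_eq_norm]; exact (hclose q p).trans_lt hq2)
    rw [dist_eq_norm] at i1
    have i2 := hnorm (dtt (ψ q) p + f (dxx (ψ q) p))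
    have i3 := (hψ q).1.1.bm p
    have i4 := (hψ q).1.1.bp p
    have i5 := norm_add_le (f (u p) - f (dxx (ψ q) p)) (dtt (ψ q) p + f (dxx (ψ q) p))
    have e : f (u p) - f (dxx (ψ q) p) + (dtt (ψ q) p + f (dxx (ψ q) p)) = f (u p) + dtt (ψ q) p := by
      abel
    rw [e] at i5
    linarith
  · intro x
    refine tendsto_nhds_unique (hu (0, x)) (tendsto_const_nhds.congr fun q => ?_)
    exact ((hψ q).1.1.outx 0 x (Or.inl (by have := (hinv q).1; linarith))).symm
  · by_contra hcon
    push Not at hcon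
    set w : ℕ → E2 := fun q => ψ q (5 / 2, 1 / 4) - ψ q (5 / 2, 0) - (1 / 4 : ℝ) • c with hwd
    have hw1 : ∀ q, g / 2 * (1 + 1 / 2 ^ q) ≤ ‖w q‖ := by
      intro q
      induction q with
      | zero =>
        have : ‖w 0‖ = g := by simp only [hwd, hψ0, hgd]
        rw [this]; norm_num
      | succ q ih =>
        have i1 := (hψ q).2.2 (5 / 2) (1 / 4)
        have e : ψ (q + 1) (5 / 2, 1 / 4) - ψ (q + 1) (5 / 2, 0) -
            (ψ q (5 / 2, 1 / 4) - ψ q (5 / 2, 0)) = w (q + 1) - w q := by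
          simp only [hwd]; abel
        rw [e] at i1
        have i2 := norm_sub_norm_le (w q) (w (q + 1))
        rw [norm_sub_rev (w q) (w (q + 1))] at i2
        rw [hhalf q]
        linarith
    have hw2 : ∀ q, ‖w q‖ ≤ 40 * κ / 2 ^ q := by
      intro q
      have hd : ∀ x ∈ (Set.univ : Set ℝ), HasDerivWithinAt (fun x : ℝ => ψ q (5 / 2, x) - x • c)
          (dxx (ψ q) (5 / 2, x) - c) Set.univ x := by
        intro x _
        have e2 := ((hasDerivAt_dxx (smooth_diff (hψ q).1.1.smooth (5 / 2, x))).sub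
          ((hasDerivAt_id x).smul_const c))
        rw [one_smul] at e2
        exact e2.hasDerivWithinAt
      have hb : ∀ x ∈ (Set.univ : Set ℝ), ‖dxx (ψ q) (5 / 2, x) - c‖ ≤ 40 * κ / 2 ^ q := by
        intro x _
        have := hclose q (5 / 2, x)
        rw [← hcon (5 / 2) x (by norm_num), norm_sub_rev] at this
        exact this
      have := convex_univ.norm_image_sub_le_of_norm_hasDerivWithin_le hd hb (Set.mem_univ 0)
        (Set.mem_univ (1 / 4))
      have e : ψ q (5 / 2, 1 / 4) - (1 / 4 : ℝ) • c - (ψ q (5 / 2, 0) - (0 : ℝ) • c) = w q := by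
        simp only [hwd, zero_smul]; abel
      rw [e] at this
      refine this.trans ?_
      rw [sub_zero, Real.norm_eq_abs, abs_of_pos (by norm_num)]
      have : 0 ≤ 40 * κ / 2 ^ q := by positivity
      linarith
    obtain ⟨q, hq⟩ := (htend.eventually_lt_const (half_pos hg)).exists
    have i1 := hw1 q
    have i2 := hw2 q
    have i3 := mul_pos hg (hinv q).1
    linarith

end helpers

/-- there is `ε > 0` such that every `2×2` strictly hyperbolic system of
conservation laws satisfying condition `C_ε` (expressed below through the eigenvalue
fields `Λ∓ = Λm, Λp`, the smooth unit right eigenvector fields `r∓ = rm, rp`, the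
normalized left eigenvectors `lm, lp` of `Df(0)`, the spectral gap `δΛ = Λp 0 - Λm 0`,
`A = |det(rm 0, rp 0)|` and the curvatures `κ∓ = A·((r∓·∇)r∓)·l±` at `0`) admits, for
some `η > 0` and for every ball `B ⊆ B(0,η)`, at least two distinct global continuous
weak solutions on `[0,∞) × 𝕋` with values in `B` and the same initial value. -/
theorem nonuniqueness_of_continuous_solutions :
    ∃ ε : ℝ, 0 < ε ∧
      ∀ (V : Set E2) (f : E2 → E2) (Λm Λp : E2 → ℝ) (rm rp : E2 → E2) (lm lp : E2),
        IsOpen V → (0 : E2) ∈ V →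
        ContDiffOn ℝ (⊤ : ℕ∞) f V →
        ContDiffOn ℝ (⊤ : ℕ∞) Λm V → ContDiffOn ℝ (⊤ : ℕ∞) Λp V →
        ContDiffOn ℝ (⊤ : ℕ∞) rm V → ContDiffOn ℝ (⊤ : ℕ∞) rp V →
        (∀ v ∈ V, Λm v < Λp v) →
        (∀ v ∈ V, ‖rm v‖ = 1) → (∀ v ∈ V, ‖rp v‖ = 1) →
        (∀ v ∈ V, fderiv ℝ f v (rm v) = Λm v • rm v) →
        (∀ v ∈ V, fderiv ℝ f v (rp v) = Λp v • rp v) →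
        (∀ w : E2, dot2 lm (fderiv ℝ f 0 w) = Λm 0 * dot2 lm w) →
        (∀ w : E2, dot2 lp (fderiv ℝ f 0 w) = Λp 0 * dot2 lp w) →
        dot2 lm (rm 0) = 1 → dot2 lp (rp 0) = 1 →
        -- condition C_ε: κ₋ > 0, κ₊ > 0,
        -- |(∇Λ⁻·r₋)(0)| ≤ ε κ₊ δΛ / A and |(∇Λ⁺·r₊)(0)| ≤ ε κ₋ δΛ / A
        0 < |det2 (rm 0) (rp 0)| * dot2 (fderiv ℝ rm 0 (rm 0)) lp →
        0 < |det2 (rm 0) (rp 0)| * dot2 (fderiv ℝ rp 0 (rp 0)) lm →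
        |fderiv ℝ Λm 0 (rm 0)| ≤
          ε * (|det2 (rm 0) (rp 0)| * dot2 (fderiv ℝ rp 0 (rp 0)) lm) * (Λp 0 - Λm 0)
            / |det2 (rm 0) (rp 0)| →
        |fderiv ℝ Λp 0 (rp 0)| ≤
          ε * (|det2 (rm 0) (rp 0)| * dot2 (fderiv ℝ rm 0 (rm 0)) lp) * (Λp 0 - Λm 0)
            / |det2 (rm 0) (rp 0)| →
        ∃ η : ℝ, 0 < η ∧
          ∀ (c : E2) (ρ : ℝ), 0 < ρ → Metric.ball c ρ ⊆ Metric.ball (0 : E2) η →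
            ∃ u₁ u₂ : ℝ × ℝ → E2,
              IsContWeakSol f (Metric.ball c ρ) u₁ ∧
              IsContWeakSol f (Metric.ball c ρ) u₂ ∧
              (∀ x, u₁ (0, x) = u₂ (0, x)) ∧
              ∃ t x : ℝ, 0 ≤ t ∧ u₁ (t, x) ≠ u₂ (t, x) := by
  refine ⟨1 / 100, by norm_num, ?_⟩
  intro V f Λm Λp rm rp lm lp hV h0 hf hΛm hΛp hrm hrp hlt hnm hnp hem hep hlm hlp hlm1 hlp1
    hκm hκp hgm hgp
  have hgap : 0 < Λp 0 - Λm 0 := sub_pos.2 (hlt 0 h0)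
  have hA : 0 < |det2 (rm 0) (rp 0)| := by
    rcases (abs_nonneg (det2 (rm 0) (rp 0))).eq_or_lt with h | h
    · rw [← h] at hκm; simp at hκm
    · exact h
  have dm : 0 < dot2 lp (fderiv ℝ rm 0 (rm 0)) := by
    rw [dot2_comm]; exact pos_of_mul_pos_right hκm hA.le
  have dp : 0 < dot2 lm (fderiv ℝ rp 0 (rp 0)) := by
    rw [dot2_comm]; exact pos_of_mul_pos_right hκp hA.le
  have o1 : dot2 lm (rp 0) = 0 := by
    have e := hlm (rp 0)
    rw [hep 0 h0, dot2_smul] at e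
    have e2 : (Λp 0 - Λm 0) * dot2 lm (rp 0) = 0 := by linarith
    exact (mul_eq_zero.1 e2).resolve_left hgap.ne'
  have o2 : dot2 lp (rm 0) = 0 := by
    have e := hlp (rm 0)
    rw [hem 0 h0, dot2_smul] at e
    have e2 : (Λp 0 - Λm 0) * dot2 lp (rm 0) = 0 := by linarith
    exact (mul_eq_zero.1 e2).resolve_left hgap.ne'
  obtain ⟨kp, hkpd⟩ : ∃ kp, kp = (Λp 0 - Λm 0) * dot2 lm (fderiv ℝ rp 0 (rp 0)) := ⟨_, rfl⟩
  obtain ⟨km, hkmd⟩ : ∃ km, km = (Λp 0 - Λm 0) * dot2 lp (fderiv ℝ rm 0 (rm 0)) := ⟨_, rfl⟩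
  have hkp : 0 < kp := by rw [hkpd]; exact mul_pos hgap dp
  have hkm : 0 < km := by rw [hkmd]; exact mul_pos hgap dm
  have hμm : |fderiv ℝ Λm 0 (rm 0)| ≤ 1 / 100 * kp := by
    refine hgm.trans (le_of_eq ?_)
    rw [hkpd, dot2_comm lm]
    have hA' := hA.ne'
    field_simp
  have hμp : |fderiv ℝ Λp 0 (rp 0)| ≤ 1 / 100 * km := by
    refine hgp.trans (le_of_eq ?_)
    rw [hkmd, dot2_comm lp]
    have hA' := hA.ne'
    field_simp
  have hBp := second_expand hV h0 hf hΛp hrp hep hlp hlm hlp1 o2 o1 hlm1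
  have hBm := second_expand hV h0 hf hΛm hrm hem hlm hlp hlm1 o1 o2 hlp1
  rw [← hkpd] at hBp
  have hkm' : (Λm 0 - Λp 0) * dot2 lp (fderiv ℝ rm 0 (rm 0)) = -km := by rw [hkmd]; ring
  rw [hkm'] at hBm
  obtain ⟨C, hCd⟩ : ∃ C, C = ‖dotL lm‖ + ‖dotL lp‖ + 1 := ⟨_, rfl⟩
  have n1 := norm_nonneg (dotL lm)
  have n2 := norm_nonneg (dotL lp)
  have hC : 0 < C := by rw [hCd]; positivity
  have hCm : ∀ w, |dotL lm w| ≤ C * ‖w‖ := fun w =>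
    ((dotL lm).le_opNorm w).trans
      (mul_le_mul_of_nonneg_right (by rw [hCd]; linarith) (norm_nonneg _))
  have hCp : ∀ w, |dotL lp w| ≤ C * ‖w‖ := fun w =>
    ((dotL lp).le_opNorm w).trans
      (mul_le_mul_of_nonneg_right (by rw [hCd]; linarith) (norm_nonneg _))
  obtain ⟨σ, hσd⟩ : ∃ σ, σ = min kp km / (384 * C) := ⟨_, rfl⟩
  have hmin : 0 < min kp km := lt_min hkp hkm
  have hσ0 : 0 < σ := by rw [hσd]; positivity
  have hσe : 24 * σ * C = min kp km / 16 := by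
    rw [hσd]; field_simp; norm_num
  have hσ1 : 24 * σ * C ≤ kp / 16 := by
    rw [hσe]; have := min_le_left kp km; linarith
  have hσ2 : 24 * σ * C ≤ km / 16 := by
    rw [hσe]; have := min_le_right kp km; linarith
  obtain ⟨ηp, hηp, hballp, Wp⟩ := wave_step hV h0 hf hΛp hrp hnp hep (hem 0 h0)
    (hlt 0 h0).ne hBp hσ0
  obtain ⟨ηm, hηm, hballm, Wm⟩ := wave_step hV h0 hf hΛm hrm hnm hem (hep 0 h0)
    (hlt 0 h0).ne' hBm hσ0
  have Wp' : WaveProp f (rm 0) (rp 0) kp (fderiv ℝ Λp 0 (rp 0)) σ (min ηp ηm) :=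
    WaveProp.mono (η := ηp) Wp (min_le_left _ _)
  have Wm' : WaveProp f (rp 0) (rm 0) (-km) (fderiv ℝ Λm 0 (rm 0)) σ (min ηp ηm) :=
    WaveProp.mono (η := ηm) Wm (min_le_right _ _)
  have hη : 0 < min ηp ηm := lt_min hηp hηm
  have hball : Metric.ball (0 : E2) (min ηp ηm) ⊆ V :=
    (Metric.ball_subset_ball (min_le_left _ _)).trans hballp
  have hnorm : ∀ w, ‖w‖ ≤ |dotL lm w| + |dotL lp w| := by
    intro w
    have e := basis2 hlm1 o1 o2 hlp1 w
    calc ‖w‖ = ‖dot2 lm w • rm 0 + dot2 lp w • rp 0‖ := by rw [← e]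
      _ ≤ ‖dot2 lm w • rm 0‖ + ‖dot2 lp w • rp 0‖ := norm_add_le _ _
      _ = |dotL lm w| + |dotL lp w| := by
        rw [norm_smul, norm_smul, hnm 0 h0, hnp 0 h0, mul_one, mul_one]; rfl
  refine ⟨min ηp ηm / 2, by positivity, ?_⟩
  intro c ρ hρ hcρ
  obtain ⟨u, hu, hu0, t, x, ht, hne⟩ := core hf hη hball (Lm := dotL lm) (Lp := dotL lp)
    hlm1 o1 o2 hlp1 (hnm 0 h0) hnorm hkm hkp hμp hμm hσ0 hC hCm hCp hσ1 hσ2 Wp' Wm' hρ hcρ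
  exact ⟨fun _ => c, u, const_sol (Metric.mem_ball_self hρ), hu, fun x => (hu0 x).symm,
    t, x, ht, hne⟩
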